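/- arXiv:1911.05794 — 5 statements merged into one kernel-verified Lean document; each statement's English description precedes it below -/
import Mathlib

section
/- For every ε > 0 there exist a finite connected simple graph G on n vertices and two distinct nonadjacent vertices u and v of G such that, letting H be the graph obtained from G by adding the edge uv, one has Den(G) − Den(H) > 1/3 − ε. In other words, adding a single edge between two nonadjacent vertices of a connected graph can decrease the density by an amount arbitrarily close to 1/3. -/
open Filter Topology

noncomputable section

namespace SubtreePaper

/-- The set of subtrees of `G`: subgraphs of `G` that are (nonempty) trees. -/
def subtrees {V : Type*} (G : SimpleGraph V) : Set G.Subgraph :=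
  {H | H.coe.IsTree}

/-- The number of subtrees of `G`. -/
def numSubtrees {V : Type*} (G : SimpleGraph V) : ℕ := (subtrees G).ncard

/-- The mean subtree order of `G`. -/
def mu {V : Type*} (G : SimpleGraph V) : ℝ :=
  (∑ᶠ H ∈ subtrees G, (H.verts.ncard : ℝ)) / (numSubtrees G)

/-- The density of `G`. -/
def den {V : Type*} [Fintype V] (G : SimpleGraph V) : ℝ :=
  mu G / (Fintype.card V)

/-- The local mean subtree order of `G` at an edge `e`. -/
def muEdge {V : Type*} (G : SimpleGraph V) (e : Sym2 V) : ℝ :=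
  (∑ᶠ H ∈ {H ∈ subtrees G | e ∈ H.edgeSet}, (H.verts.ncard : ℝ)) /
    ({H ∈ subtrees G | e ∈ H.edgeSet}.ncard)

/-- The local mean subtree order of `G` at a vertex `u`. -/
def muVert {V : Type*} (G : SimpleGraph V) (u : V) : ℝ :=
  (∑ᶠ H ∈ {H ∈ subtrees G | u ∈ H.verts}, (H.verts.ncard : ℝ)) /
    ({H ∈ subtrees G | u ∈ H.verts}.ncard)

/-- The graph obtained from `G` by adding an edge between `u` and `v`. -/
def addEdge {V : Type*} (G : SimpleGraph V) (u v : V) : SimpleGraph V :=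
  G ⊔ SimpleGraph.fromEdgeSet {s(u, v)}


lemma exists_adj_of_cut {V : Type*} {K : SimpleGraph V} {T : K.Subgraph}
    (hT : T.coe.Connected) (S : Set V) {x y : V} (hx : x ∈ T.verts) (hy : y ∈ T.verts)
    (hxS : x ∈ S) (hyS : y ∉ S) : ∃ a b, T.Adj a b ∧ a ∈ S ∧ b ∉ S := by
  obtain ⟨p⟩ := hT.preconnected ⟨x, hx⟩ ⟨y, hy⟩
  obtain ⟨d, -, h1, h2⟩ := p.exists_boundary_dart (Subtype.val ⁻¹' S) hxS hyS
  exact ⟨_, _, d.adj, h1, h2⟩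

lemma coe_connected_of_closed {V : Type*} {K : SimpleGraph V} (T : K.Subgraph) {r : V}
    (hr : r ∈ T.verts)
    (h : ∀ S : Set V, r ∈ S → (∀ a b, a ∈ S → T.Adj a b → b ∈ S) → T.verts ⊆ S) :
    T.coe.Connected := by
  have key : ∀ x (hx : x ∈ T.verts), T.coe.Reachable ⟨r, hr⟩ ⟨x, hx⟩ := by
    intro x hx
    have := h {y | ∃ hy : y ∈ T.verts, T.coe.Reachable ⟨r, hr⟩ ⟨y, hy⟩}
      ⟨hr, SimpleGraph.Reachable.refl _⟩ (by
        rintro a b ⟨ha, hra⟩ hab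
        refine ⟨T.edge_vert hab.symm, hra.trans (SimpleGraph.Adj.reachable ?_)⟩
        simpa using hab) hx
    exact this.2
  refine SimpleGraph.connected_iff_exists_forall_reachable _ |>.2 ⟨⟨r, hr⟩, fun w => key w.1 w.2⟩

lemma coe_isAcyclic_of_cuts {V : Type*} [LinearOrder V] {K : SimpleGraph V} (T : K.Subgraph)
    (h : ∀ x y, x < y → T.Adj x y → ∃ S : Set V, (x ∈ S ↔ y ∉ S) ∧
      ∀ a b, T.Adj a b → a ∈ S → b ∉ S → s(a, b) = s(x, y)) : T.coe.IsAcyclic := by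
  have h' : ∀ x y, T.Adj x y → ∃ S : Set V, (x ∈ S ↔ y ∉ S) ∧
      ∀ a b, T.Adj a b → a ∈ S → b ∉ S → s(a, b) = s(x, y) := by
    intro x y hxy
    rcases lt_or_gt_of_ne hxy.ne with hlt | hlt
    · exact h x y hlt hxy
    · obtain ⟨S, h1, h2⟩ := h y x hlt hxy.symm
      exact ⟨S, by tauto, fun a b hab ha hb => (h2 a b hab ha hb).trans Sym2.eq_swap⟩
  rw [SimpleGraph.isAcyclic_iff_forall_adj_isBridge]
  intro v w hvw
  rw [SimpleGraph.isBridge_iff]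
  intro hr
  obtain ⟨S, h1, h2⟩ := h' v w hvw
  have main : ∀ a b : T.verts, s(a, b) = s(v, w) → (a : V) ∈ S → (b : V) ∉ S →
      ¬ (T.coe.deleteEdges {s(v, w)}).Reachable a b := by
    rintro a b hab ha hb ⟨p⟩
    obtain ⟨d, -, hd1, hd2⟩ := p.exists_boundary_dart (Subtype.val ⁻¹' S) ha hb
    have hd := d.adj
    rw [SimpleGraph.deleteEdges_adj] at hd
    refine hd.2 ?_
    have := h2 _ _ hd.1 hd1 hd2
    simp only [Sym2.eq_iff] at this
    simp only [Set.mem_singleton_iff, Sym2.eq_iff, Subtype.ext_iff]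
    exact this
  by_cases hv : (v : V) ∈ S
  · exact main v w rfl hv (h1.1 hv) hr
  · exact main w v Sym2.eq_swap (by tauto) hv hr.symm

/-- The edges of the double broom, oriented increasingly: the vertices `x < m` are leaves attached
to `m`, the vertices from `m` to `M` form a path, and the vertices `x > M` are leaves attached
to `M`. -/
def BroomRel (m M x y : ℕ) : Prop :=
  (x < m ∧ y = m) ∨ (m ≤ x ∧ y = x + 1 ∧ y ≤ M) ∨ (x = M ∧ M < y)

/-- The double broom: a path with `M - m + 1` vertices and `m` leaves at each of its ends. -/
def broom (m M : ℕ) : SimpleGraph (Fin (M + 1 + m)) where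
  Adj x y := BroomRel m M x y ∨ BroomRel m M y x
  symm := ⟨fun _ _ h => h.symm⟩
  loopless := ⟨fun x h => by simp only [BroomRel] at h; omega⟩

lemma broom_exists_cut {m M : ℕ} (hm : m < M) {x y : Fin (M + 1 + m)} (hxy : BroomRel m M x y) :
    ∃ S : Set (Fin (M + 1 + m)), x ∈ S ∧ y ∉ S ∧
      ∀ a b, (broom m M).Adj a b → a ∈ S → b ∉ S → a = x ∧ b = y := by
  have hxy' := hxy
  rcases hxy with h | h | h
  · refine ⟨{z | z = x}, rfl, ?_, ?_⟩
    · simp only [Set.mem_ofPred_eq, Fin.ext_iff]; omega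
    · intro a b hab ha hb
      simp only [broom, BroomRel, Set.mem_ofPred_eq, Fin.ext_iff] at *
      omega
  · refine ⟨{z | z ≤ x}, le_refl x, ?_, ?_⟩
    · simp only [Set.mem_ofPred_eq, Fin.le_def]; omega
    · intro a b hab ha hb
      simp only [broom, BroomRel, Set.mem_ofPred_eq, Fin.le_def, Fin.ext_iff] at *
      omega
  · refine ⟨{z | z ≠ y}, ?_, ?_, ?_⟩
    · simp only [Set.mem_ofPred_eq, Fin.ext_iff, ne_eq]; omega
    · simp
    · intro a b hab ha hb
      simp only [broom, BroomRel, Set.mem_ofPred_eq, Fin.ext_iff, ne_eq] at *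
      omega

section SubtreesInBroom

variable {m M : ℕ} {K : SimpleGraph (Fin (M + 1 + m))} {T : K.Subgraph}

lemma adj_of_broomRel (hm : m < M) (hT : T.coe.Connected)
    (hsub : ∀ x y, T.Adj x y → (broom m M).Adj x y)
    {x y : Fin (M + 1 + m)} (hx : x ∈ T.verts) (hy : y ∈ T.verts) (hxy : BroomRel m M x y) :
    T.Adj x y := by
  obtain ⟨S, hxS, hyS, hS⟩ := broom_exists_cut hm hxy
  obtain ⟨a, b, hab, ha, hb⟩ := exists_adj_of_cut hT S hx hy hxS hyS
  obtain ⟨rfl, rfl⟩ := hS a b (hsub a b hab) ha hb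
  exact hab

lemma subtree_ext_of_verts (hm : m < M) (hT : T.coe.Connected)
    (hsub : ∀ x y, T.Adj x y → (broom m M).Adj x y) {T' : K.Subgraph} (hT' : T'.coe.Connected)
    (hsub' : ∀ x y, T'.Adj x y → (broom m M).Adj x y) (h : T.verts = T'.verts) : T = T' := by
  have aux : ∀ {T T' : K.Subgraph}, T'.coe.Connected →
      (∀ x y, T.Adj x y → (broom m M).Adj x y) →
      (∀ x y, T'.Adj x y → (broom m M).Adj x y) → T.verts = T'.verts →
      ∀ x y, T.Adj x y → T'.Adj x y := by
    intro T T' hT' hsub hsub' h x y hxy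
    have hx : x ∈ T'.verts := h ▸ T.edge_vert hxy
    have hy : y ∈ T'.verts := h ▸ T.edge_vert hxy.symm
    rcases hsub x y hxy with h1 | h1
    · exact adj_of_broomRel hm hT' hsub' hx hy h1
    · exact (adj_of_broomRel hm hT' hsub' hy hx h1).symm
  refine SimpleGraph.Subgraph.ext h ?_
  ext x y
  exact ⟨aux hT' hsub hsub' h x y, aux hT hsub' hsub h.symm x y⟩

lemma mem_verts_of_between (hT : T.coe.Connected)
    (hsub : ∀ x y, T.Adj x y → (broom m M).Adj x y) {a b z : Fin (M + 1 + m)}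
    (ha : a ∈ T.verts) (hb : b ∈ T.verts) (haz : a ≤ z) (hzb : z ≤ b)
    (hmz : m ≤ (z : ℕ)) (hzM : (z : ℕ) ≤ M) : z ∈ T.verts := by
  rcases hzb.eq_or_lt with rfl | hlt
  · exact hb
  by_cases hz : (z : ℕ) = M
  · obtain ⟨p, q, hpq, hp, hq⟩ := exists_adj_of_cut hT {y | y ≤ z} ha hb haz (not_le.2 hlt)
    have := hsub p q hpq
    have hpz : p = z := by
      simp only [broom, BroomRel, Set.mem_ofPred_eq, Fin.le_def, Fin.lt_def, Fin.ext_iff] at *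
      omega
    exact hpz ▸ T.edge_vert hpq
  · obtain ⟨p, q, hpq, hp, hq⟩ := exists_adj_of_cut hT {y | y ≤ z} ha hb haz (not_le.2 hlt)
    have := hsub p q hpq
    have hpz : p = z := by
      simp only [broom, BroomRel, Set.mem_ofPred_eq, Fin.le_def, Fin.lt_def, Fin.ext_iff] at *
      omega
    exact hpz ▸ T.edge_vert hpq

lemma left_end_mem (hm : m < M) (hT : T.coe.Connected)
    (hsub : ∀ x y, T.Adj x y → (broom m M).Adj x y) {a b : Fin (M + 1 + m)}
    (ha : a ∈ T.verts) (hb : b ∈ T.verts) (ham : (a : ℕ) < m) (hba : b ≠ a) :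
    (⟨m, by omega⟩ : Fin (M + 1 + m)) ∈ T.verts := by
  obtain ⟨p, q, hpq, hp, hq⟩ := exists_adj_of_cut hT {y | y = a} ha hb rfl hba
  have := hsub p q hpq
  have hqm : q = ⟨m, by omega⟩ := by
    simp only [broom, BroomRel, Set.mem_ofPred_eq, Fin.ext_iff] at *
    omega
  exact hqm ▸ T.edge_vert hpq.symm

lemma right_end_mem (hm : m < M) (hT : T.coe.Connected)
    (hsub : ∀ x y, T.Adj x y → (broom m M).Adj x y) {a b : Fin (M + 1 + m)}
    (ha : a ∈ T.verts) (hb : b ∈ T.verts) (haM : M < (a : ℕ)) (hba : b ≠ a) :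
    (⟨M, by omega⟩ : Fin (M + 1 + m)) ∈ T.verts := by
  obtain ⟨p, q, hpq, hp, hq⟩ := exists_adj_of_cut hT {y | y = a} ha hb rfl hba
  have := hsub p q hpq
  have hqm : q = ⟨M, by omega⟩ := by
    simp only [broom, BroomRel, Set.mem_ofPred_eq, Fin.ext_iff] at *
    omega
  exact hqm ▸ T.edge_vert hpq.symm

end SubtreesInBroom

/-- The leaves attached to `m`. -/
def leftLeaves (m M : ℕ) : Finset (Fin (M + 1 + m)) := Finset.univ.filter fun x => (x : ℕ) < m

/-- The leaves attached to `M`. -/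
def rightLeaves (m M : ℕ) : Finset (Fin (M + 1 + m)) := Finset.univ.filter fun x => M < (x : ℕ)

lemma card_leftLeaves (m M : ℕ) : (leftLeaves m M).card = m := by
  have : (leftLeaves m M).map Fin.valEmbedding = Finset.range m := by
    ext x
    simp only [leftLeaves, Finset.mem_map, Finset.mem_filter, Finset.mem_univ, true_and,
      Fin.valEmbedding_apply, Finset.mem_range]
    exact ⟨by rintro ⟨y, hy, rfl⟩; exact hy, fun h => ⟨⟨x, by omega⟩, h, rfl⟩⟩
  rw [← Finset.card_map Fin.valEmbedding, this, Finset.card_range]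

lemma card_rightLeaves (m M : ℕ) : (rightLeaves m M).card = m := by
  have : (rightLeaves m M).map Fin.valEmbedding = Finset.Ioo M (M + 1 + m) := by
    ext x
    simp only [rightLeaves, Finset.mem_map, Finset.mem_filter, Finset.mem_univ, true_and,
      Fin.valEmbedding_apply, Finset.mem_Ioo]
    exact ⟨by rintro ⟨y, hy, rfl⟩; exact ⟨hy, y.2⟩, fun h => ⟨⟨x, h.2⟩, h.1, rfl⟩⟩
  rw [← Finset.card_map Fin.valEmbedding, this, Nat.card_Ioo]
  omega

/-- The leaves of the double broom. -/
def leaves (m M : ℕ) : Finset (Fin (M + 1 + m)) := leftLeaves m M ∪ rightLeaves m M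

lemma mem_leaves {m M : ℕ} {x : Fin (M + 1 + m)} :
    x ∈ leaves m M ↔ (x : ℕ) < m ∨ M < (x : ℕ) := by
  simp [leaves, leftLeaves, rightLeaves]

lemma card_leaves {m M : ℕ} (hm : m < M) : (leaves m M).card = 2 * m := by
  rw [leaves, Finset.card_union_of_disjoint, card_leftLeaves, card_rightLeaves, two_mul]
  rw [Finset.disjoint_left]
  simp only [leftLeaves, rightLeaves, Finset.mem_filter, Finset.mem_univ, true_and]
  omega

lemma card_powerset_leaves {m M : ℕ} (hm : m < M) : (leaves m M).powerset.card = 4 ^ m := by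
  rw [Finset.card_powerset, card_leaves hm, pow_mul]
  norm_num

open Classical in
lemma verts_toFinset_of_subtree {m M : ℕ} (hm : m < M) {K : SimpleGraph (Fin (M + 1 + m))}
    {T : K.Subgraph} (hT : T.coe.Connected)
    (hsub : ∀ x y, T.Adj x y → (broom m M).Adj x y) :
    (∃ I ∈ (leaves m M).powerset, T.verts.toFinset =
      (Finset.univ.filter fun x : Fin (M + 1 + m) => m ≤ (x : ℕ) ∧ (x : ℕ) ≤ M) ∪ I) ∨
    (∃ a b, ∃ I ∈ (leftLeaves m M).powerset, T.verts.toFinset = Finset.Icc a b ∪ I) ∨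
    (∃ a b, ∃ I ∈ (rightLeaves m M).powerset, T.verts.toFinset = Finset.Icc a b ∪ I) := by
  set W := T.verts.toFinset with hW
  have hmem : ∀ x, x ∈ T.verts ↔ x ∈ W := by simp [hW]
  have hbet := fun a b z => mem_verts_of_between (a := a) (b := b) (z := z) hT hsub
  have hle := fun a b => left_end_mem (a := a) (b := b) hm hT hsub
  have hri := fun a b => right_end_mem (a := a) (b := b) hm hT hsub
  simp only [hmem] at hbet hle hri
  have hsingle : ∀ x ∈ W, (∀ y ∈ W, y = x) → W = Finset.Icc x x ∪ ∅ := by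
    intro x hx h
    ext y
    simp only [Finset.Icc_self, Finset.union_empty, Finset.mem_singleton]
    exact ⟨h y, fun h => h ▸ hx⟩
  by_cases h1 : (⟨m, by omega⟩ : Fin (M + 1 + m)) ∈ W
  · by_cases h2 : (⟨M, by omega⟩ : Fin (M + 1 + m)) ∈ W
    · left
      refine ⟨W ∩ leaves m M, Finset.mem_powerset.2 Finset.inter_subset_right, ?_⟩
      ext z
      simp only [Finset.mem_union, Finset.mem_filter, Finset.mem_univ, true_and, Finset.mem_inter,
        mem_leaves]
      have := hbet _ _ z h1 h2
      simp only [Fin.le_def] at this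
      constructor
      · intro hz
        simp only [hz, true_and]
        omega
      · rintro (⟨h3, h4⟩ | h)
        · exact this h3 h4 h3 h4
        · exact h.1
    · right; left
      by_cases h3 : ∃ x ∈ W, M < (x : ℕ)
      · obtain ⟨x, hx, hxM⟩ := h3
        refine ⟨x, x, ∅, by simp, hsingle x hx fun y hy => ?_⟩
        by_contra hne
        exact h2 (hri x y hx hy hxM hne)
      · push Not at h3
        set P := W.filter fun x : Fin (M + 1 + m) => m ≤ (x : ℕ) with hP
        have hPne : P.Nonempty := ⟨_, Finset.mem_filter.2 ⟨h1, le_refl m⟩⟩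
        obtain ⟨a, hmin, hmin'⟩ : ∃ a ∈ P, ∀ z ∈ P, a ≤ z :=
          ⟨P.min' hPne, P.min'_mem hPne, fun z => P.min'_le z⟩
        obtain ⟨b, hmax, hmax'⟩ : ∃ b ∈ P, ∀ z ∈ P, z ≤ b :=
          ⟨P.max' hPne, P.max'_mem hPne, fun z => P.le_max' z⟩
        refine ⟨a, b, W ∩ leftLeaves m M,
          Finset.mem_powerset.2 Finset.inter_subset_right, ?_⟩
        rw [hP, Finset.mem_filter] at hmin hmax
        ext z
        simp only [Finset.mem_union, Finset.mem_Icc, Finset.mem_inter, leftLeaves,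
          Finset.mem_filter, Finset.mem_univ, true_and, hP] at *
        constructor
        · intro hz
          by_cases hzm : (z : ℕ) < m
          · exact Or.inr ⟨hz, hzm⟩
          · exact Or.inl ⟨hmin' z ⟨hz, by omega⟩, hmax' z ⟨hz, by omega⟩⟩
        · rintro (⟨h4, h5⟩ | h)
          · refine hbet _ _ z hmin.1 hmax.1 h4 h5 ?_ ?_
            · exact hmin.2.trans h4
            · exact le_trans (Fin.le_def.1 h5) (h3 _ hmax.1)
          · exact h.1
  · right; right
    by_cases h3 : ∃ x ∈ W, (x : ℕ) < m
    · obtain ⟨x, hx, hxM⟩ := h3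
      refine ⟨x, x, ∅, by simp, hsingle x hx fun y hy => ?_⟩
      by_contra hne
      exact h1 (hle x y hx hy hxM hne)
    · push Not at h3
      set P := W.filter fun x : Fin (M + 1 + m) => (x : ℕ) ≤ M with hP
      by_cases hPne : P.Nonempty
      · obtain ⟨a, hmin, hmin'⟩ : ∃ a ∈ P, ∀ z ∈ P, a ≤ z :=
          ⟨P.min' hPne, P.min'_mem hPne, fun z => P.min'_le z⟩
        obtain ⟨b, hmax, hmax'⟩ : ∃ b ∈ P, ∀ z ∈ P, z ≤ b :=
          ⟨P.max' hPne, P.max'_mem hPne, fun z => P.le_max' z⟩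
        refine ⟨a, b, W ∩ rightLeaves m M,
          Finset.mem_powerset.2 Finset.inter_subset_right, ?_⟩
        rw [hP, Finset.mem_filter] at hmin hmax
        ext z
        simp only [Finset.mem_union, Finset.mem_Icc, Finset.mem_inter, rightLeaves,
          Finset.mem_filter, Finset.mem_univ, true_and, hP] at *
        constructor
        · intro hz
          by_cases hzm : M < (z : ℕ)
          · exact Or.inr ⟨hz, hzm⟩
          · exact Or.inl ⟨hmin' z ⟨hz, by omega⟩, hmax' z ⟨hz, by omega⟩⟩
        · rintro (⟨h4, h5⟩ | h)
          · refine hbet _ _ z hmin.1 hmax.1 h4 h5 ?_ ?_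
            · exact (h3 _ hmin.1).trans h4
            · exact le_trans (Fin.le_def.1 h5) hmax.2
          · exact h.1
      · refine ⟨⟨1, by omega⟩, ⟨0, by omega⟩, W, ?_, ?_⟩
        · rw [Finset.mem_powerset]
          intro z hz
          rw [Finset.not_nonempty_iff_eq_empty, hP, Finset.filter_eq_empty_iff] at hPne
          simpa [rightLeaves] using hPne hz
        · rw [Finset.Icc_eq_empty (by simp), Finset.empty_union]

/-- The number of subtrees with all edges in the double broom is at most `4 ^ m` plus a
lower-order term. -/
lemma ncard_subtrees_in_broom_le {m M : ℕ} (hm : m < M) (K : SimpleGraph (Fin (M + 1 + m))) :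
    {T ∈ subtrees K | ∀ x y, T.Adj x y → (broom m M).Adj x y}.ncard ≤
      4 ^ m + 2 * (M + 1 + m) ^ 2 * 2 ^ m := by
  classical
  let C (L : Finset (Fin (M + 1 + m))) : Finset (Finset (Fin (M + 1 + m))) :=
    ((Finset.univ ×ˢ Finset.univ) ×ˢ L.powerset).image fun p => Finset.Icc p.1.1 p.1.2 ∪ p.2
  let C₀ : Finset (Finset (Fin (M + 1 + m))) := (leaves m M).powerset.image fun I =>
    (Finset.univ.filter fun x : Fin (M + 1 + m) => m ≤ (x : ℕ) ∧ (x : ℕ) ≤ M) ∪ I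
  have hC : ∀ L, L.card = m → (C L).card ≤ (M + 1 + m) ^ 2 * 2 ^ m := by
    intro L hL
    refine Finset.card_image_le.trans (le_of_eq ?_)
    simp [Finset.card_product, hL, sq]
  have hC₀ : C₀.card ≤ 4 ^ m := Finset.card_image_le.trans (card_powerset_leaves hm).le
  calc _ ≤ ((C₀ ∪ (C (leftLeaves m M) ∪ C (rightLeaves m M)) :
          Finset (Finset (Fin (M + 1 + m)))) : Set (Finset (Fin (M + 1 + m)))).ncard := by
        refine Set.ncard_le_ncard_of_injOn (fun T => T.verts.toFinset) ?_ ?_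
          (Finset.finite_toSet _)
        · rintro T ⟨hT, hsub⟩
          simp only [Finset.coe_union, Set.mem_union, Finset.mem_coe]
          have hT' : T.coe.IsTree := hT
          rcases verts_toFinset_of_subtree hm hT'.connected hsub with
            ⟨I, hI, h⟩ | ⟨a, b, I, hI, h⟩ | ⟨a, b, I, hI, h⟩
          · exact Or.inl (Finset.mem_image.2 ⟨I, hI, h.symm⟩)
          · exact Or.inr (Or.inl (Finset.mem_image.2 ⟨((a, b), I), by simpa using hI, h.symm⟩))
          · exact Or.inr (Or.inr (Finset.mem_image.2 ⟨((a, b), I), by simpa using hI, h.symm⟩))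
        · rintro T ⟨hT, hsub⟩ T' ⟨hT', hsub'⟩ h
          exact subtree_ext_of_verts hm (SimpleGraph.IsTree.connected hT) hsub
            (SimpleGraph.IsTree.connected hT') hsub' (by simpa using h)
    _ ≤ 4 ^ m + ((M + 1 + m) ^ 2 * 2 ^ m + (M + 1 + m) ^ 2 * 2 ^ m) := by
        rw [Set.ncard_coe_finset]
        refine (Finset.card_union_le _ _).trans (add_le_add hC₀ ?_)
        exact (Finset.card_union_le _ _).trans
          (add_le_add (hC _ (card_leftLeaves m M)) (hC _ (card_rightLeaves m M)))
    _ = _ := by ring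

/-- The subtree of the double broom containing the whole path and the leaves in `I`. -/
def fullTree (m M : ℕ) (I : Finset (Fin (M + 1 + m))) : (broom m M).Subgraph where
  verts := {x | (m ≤ (x : ℕ) ∧ (x : ℕ) ≤ M) ∨ x ∈ I}
  Adj x y := (broom m M).Adj x y ∧ ((m ≤ (x : ℕ) ∧ (x : ℕ) ≤ M) ∨ x ∈ I) ∧
    ((m ≤ (y : ℕ) ∧ (y : ℕ) ≤ M) ∨ y ∈ I)
  adj_sub h := h.1
  edge_vert h := h.2.1
  symm := ⟨fun _ _ h => ⟨h.1.symm, h.2.2, h.2.1⟩⟩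

lemma fullTree_isTree {m M : ℕ} (hm : m < M) {I : Finset (Fin (M + 1 + m))} :
    (fullTree m M I).coe.IsTree := by
  constructor
  · refine coe_connected_of_closed _ (r := ⟨m, by omega⟩) (Or.inl ⟨le_rfl, hm.le⟩) ?_
    intro S hS hcl x hx
    have hpath : ∀ j (hj : m + j ≤ M), (⟨m + j, by omega⟩ : Fin (M + 1 + m)) ∈ S := by
      intro j
      induction j with
      | zero => exact fun _ => hS
      | succ j ih =>
        intro hj
        refine hcl _ _ (ih (by omega)) ⟨?_, Or.inl ?_, Or.inl ?_⟩
        · simp only [broom, BroomRel]; omega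
        · simp only; omega
        · simp only; omega
    rcases lt_trichotomy (x : ℕ) m with h | h | h
    · refine hcl _ _ hS ⟨?_, Or.inl ⟨le_rfl, hm.le⟩, hx⟩
      exact Or.inr (Or.inl ⟨h, rfl⟩)
    · exact (Fin.ext h : x = ⟨m, by omega⟩) ▸ hS
    · by_cases hxM : (x : ℕ) ≤ M
      · have := hpath (x - m) (by omega)
        convert this using 1
        exact Fin.ext (by simp only; omega)
      · have hM := hpath (M - m) (by omega)
        refine hcl _ _ hM ⟨?_, Or.inl ?_, hx⟩
        · simp only [broom, BroomRel]; omega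
        · simp only; omega
  · refine coe_isAcyclic_of_cuts _ fun x y hlt hxy => ?_
    have hxy' : BroomRel m M x y := by
      rcases hxy.1 with h | h
      · exact h
      · simp only [BroomRel, Fin.lt_def] at *; omega
    obtain ⟨S, h1, h2, h3⟩ := broom_exists_cut hm hxy'
    refine ⟨S, by tauto, fun a b hab ha hb => ?_⟩
    obtain ⟨rfl, rfl⟩ := h3 a b hab.1 ha hb
    rfl

lemma fullTree_injOn (m M : ℕ) :
    Set.InjOn (fullTree m M) ((leaves m M).powerset : Set (Finset (Fin (M + 1 + m)))) := by
  have aux : ∀ I ∈ (leaves m M).powerset, ∀ x, x ∈ I ↔ x ∈ leaves m M ∧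
      x ∈ (fullTree m M I).verts := by
    intro I hI x
    have := @Finset.mem_powerset _ I (leaves m M) |>.1 hI
    refine ⟨fun hx => ⟨this hx, Or.inr hx⟩, ?_⟩
    rintro ⟨h1, h2 | h2⟩
    · rw [mem_leaves] at h1; omega
    · exact h2
  intro I hI J hJ h
  ext x
  rw [aux I hI, aux J hJ, h]

lemma le_ncard_fullTree_verts {m M : ℕ} (I : Finset (Fin (M + 1 + m))) :
    M + 1 - m ≤ (fullTree m M I).verts.ncard := by
  calc M + 1 - m = ((Finset.Icc m M : Finset ℕ) : Set ℕ).ncard := by simp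
    _ ≤ (Fin.val '' (fullTree m M I).verts).ncard := by
        refine Set.ncard_le_ncard ?_ (Set.toFinite _)
        intro x hx
        rw [Finset.coe_Icc, Set.mem_Icc] at hx
        exact ⟨⟨x, by omega⟩, Or.inl hx, rfl⟩
    _ ≤ _ := Set.ncard_image_le (Set.toFinite _)

/-- The double broom with the ends of its path joined by an edge. -/
abbrev closedBroom (m M : ℕ) : SimpleGraph (Fin (M + 1 + m)) :=
  addEdge (broom m M) ⟨m, by omega⟩ ⟨M, by omega⟩

lemma closedBroom_adj {m M : ℕ} (hm : m < M) {x y : Fin (M + 1 + m)} :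
    (closedBroom m M).Adj x y ↔ (broom m M).Adj x y ∨ ((x : ℕ) = m ∧ (y : ℕ) = M) ∨
      ((x : ℕ) = M ∧ (y : ℕ) = m) := by
  simp only [closedBroom, addEdge, SimpleGraph.sup_adj, SimpleGraph.fromEdgeSet_adj,
    Set.mem_singleton_iff, Sym2.eq_iff, Fin.ext_iff, ne_eq]
  refine or_congr_right ?_
  omega

/-- The subtree of the closed double broom obtained by removing the vertices strictly between
`k` and `l + 1` and the edge from `k` to `k + 1`, with leaves in `I`. -/
def splitTree (m M : ℕ) (k l : ℕ) (I : Finset (Fin (M + 1 + m))) :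
    (closedBroom m M).Subgraph where
  verts := {x | (m ≤ (x : ℕ) ∧ (x : ℕ) ≤ k) ∨ (l + 1 ≤ (x : ℕ) ∧ (x : ℕ) ≤ M) ∨ x ∈ I}
  Adj x y := (closedBroom m M).Adj x y ∧
    ((m ≤ (x : ℕ) ∧ (x : ℕ) ≤ k) ∨ (l + 1 ≤ (x : ℕ) ∧ (x : ℕ) ≤ M) ∨ x ∈ I) ∧
    ((m ≤ (y : ℕ) ∧ (y : ℕ) ≤ k) ∨ (l + 1 ≤ (y : ℕ) ∧ (y : ℕ) ≤ M) ∨ y ∈ I) ∧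
    ¬ ((x : ℕ) = k ∧ (y : ℕ) = k + 1) ∧ ¬ ((y : ℕ) = k ∧ (x : ℕ) = k + 1)
  adj_sub h := h.1
  edge_vert h := h.2.1
  symm := ⟨fun _ _ h => ⟨h.1.symm, h.2.2.1, h.2.1, h.2.2.2.2, h.2.2.2.1⟩⟩

section SplitTree

variable {m M : ℕ} {k l : ℕ} {I : Finset (Fin (M + 1 + m))}

lemma splitTree_connected (hM : m + 2 ≤ M) (hmk : m ≤ k) (hkl : k ≤ l) (hlM : l < M)
    (hI : I ∈ (leaves m M).powerset) : (splitTree m M k l I).coe.Connected := by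
  rw [Finset.mem_powerset] at hI
  refine coe_connected_of_closed _ (r := ⟨m, by omega⟩) (Or.inl ⟨le_rfl, hmk⟩) ?_
  intro S hS hcl x hx
  have hleft : ∀ j (hj : m + j ≤ k), (⟨m + j, by omega⟩ : Fin (M + 1 + m)) ∈ S := by
    intro j
    induction j with
    | zero => exact fun _ => hS
    | succ j ih =>
      intro hj
      refine hcl _ _ (ih (by omega)) ⟨?_, Or.inl ?_, Or.inl ?_, ?_⟩
      · simp only [closedBroom_adj (show m < M by omega), broom, BroomRel]; omega
      all_goals simp only; omega
  have hright : ∀ j (hj : l + 1 + j ≤ M), (⟨M - j, by omega⟩ : Fin (M + 1 + m)) ∈ S := by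
    intro j
    induction j with
    | zero =>
      intro hj
      refine hcl _ _ hS ⟨?_, Or.inl ?_, Or.inr (Or.inl ?_), ?_⟩
      · exact (closedBroom_adj (by omega)).2 (Or.inr (Or.inl ⟨rfl, rfl⟩))
      all_goals simp only; omega
    | succ j ih =>
      intro hj
      refine hcl _ _ (ih (by omega)) ⟨?_, Or.inr (Or.inl ?_), Or.inr (Or.inl ?_), ?_⟩
      · simp only [closedBroom_adj (show m < M by omega), broom, BroomRel]; omega
      all_goals simp only; omega
  rcases hx with h | h | h
  · have := hleft (x - m) (by omega)
    convert this using 1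
    exact Fin.ext (by simp only; omega)
  · have := hright (M - x) (by omega)
    convert this using 1
    exact Fin.ext (by simp only; omega)
  · rcases mem_leaves.1 (hI h) with h' | h'
    · refine hcl _ _ hS ⟨?_, Or.inl ?_, Or.inr (Or.inr h), ?_⟩
      · exact (closedBroom_adj (by omega)).2 (Or.inl (Or.inr (Or.inl ⟨h', rfl⟩)))
      all_goals simp only; omega
    · refine hcl _ _ (hright 0 (by omega)) ⟨?_, Or.inr (Or.inl ?_), Or.inr (Or.inr h), ?_⟩
      · simp only [closedBroom_adj (show m < M by omega), broom, BroomRel]; omega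
      all_goals simp only; omega

lemma splitTree_isAcyclic (hmk : m ≤ k) (hkl : k ≤ l) (hlM : l < M)
    (hI : I ∈ (leaves m M).powerset) : (splitTree m M k l I).coe.IsAcyclic := by
  rw [Finset.mem_powerset] at hI
  have hverts : ∀ z : Fin (M + 1 + m), ((m ≤ (z : ℕ) ∧ (z : ℕ) ≤ k) ∨
      (l + 1 ≤ (z : ℕ) ∧ (z : ℕ) ≤ M) ∨ z ∈ I) → ((z : ℕ) ≤ k ∨ l + 1 ≤ (z : ℕ)) := by
    rintro z (h | h | h)
    · omega
    · omega
    · have := mem_leaves.1 (hI h); omega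
  refine coe_isAcyclic_of_cuts _ fun x y hlt hxy => ?_
  obtain ⟨hadj, hx, hy, hk, hk'⟩ := hxy
  replace hx := hverts x hx
  replace hy := hverts y hy
  have hS : ∀ S : ℕ → Prop, (S x ↔ ¬ S y) → (∀ a b : ℕ,
      ((BroomRel m M a b ∨ BroomRel m M b a) ∨ (a = m ∧ b = M) ∨ (a = M ∧ b = m)) →
      ¬ (a = k ∧ b = k + 1) → ¬ (b = k ∧ a = k + 1) → S a → ¬ S b →
      (a = x ∧ b = y) ∨ (a = y ∧ b = x)) →
      ∃ S : Set (Fin (M + 1 + m)), (x ∈ S ↔ y ∉ S) ∧ ∀ a b, (splitTree m M k l I).Adj a b →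
        a ∈ S → b ∉ S → s(a, b) = s(x, y) := by
    intro S h1 h2
    refine ⟨{z | S z}, h1, fun a b hab ha hb => ?_⟩
    have h3 := (closedBroom_adj (by omega)).1 hab.1
    rw [Sym2.eq_iff]
    simp only [Fin.ext_iff]
    exact h2 a b h3 hab.2.2.2.1 hab.2.2.2.2 ha hb
  rw [closedBroom_adj (by omega)] at hadj
  simp only [broom, BroomRel, Fin.lt_def] at hadj hlt hS
  by_cases hx1 : (x : ℕ) < m
  · exact hS (fun z => z = x) (by omega) (by omega)
  by_cases hy1 : M < (y : ℕ)
  · exact hS (fun z => z = y) (by omega) (by omega)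
  by_cases huv : (x : ℕ) = m ∧ (y : ℕ) = M
  · exact hS (fun z => z ≤ k) (by omega) (by omega)
  by_cases hxk : (x : ℕ) < k
  · exact hS (fun z => z ≤ x ∨ k + 1 ≤ z) (by omega) (by omega)
  · exact hS (fun z => k + 1 ≤ z ∧ z ≤ x) (by omega) (by omega)

lemma splitTree_adj_ends (hM : m + 2 ≤ M) (hmk : m ≤ k) (hkl : k ≤ l) (hlM : l < M) :
    (splitTree m M k l I).Adj ⟨m, by omega⟩ ⟨M, by omega⟩ := by
  refine ⟨?_, Or.inl ?_, Or.inr (Or.inl ?_), ?_⟩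
  · exact (closedBroom_adj (by omega)).2 (Or.inr (Or.inl ⟨rfl, rfl⟩))
  all_goals simp only; omega

lemma splitTree_adj_succ (hkl : k ≤ l)
    (hI : I ∈ (leaves m M).powerset) (i : ℕ) (hmi : m ≤ i) (hiM : i < M) :
    (splitTree m M k l I).Adj ⟨i, by omega⟩ ⟨i + 1, by omega⟩ ↔ ¬ (k ≤ i ∧ i ≤ l) := by
  rw [Finset.mem_powerset] at hI
  have h1 : ∀ z : Fin (M + 1 + m), m ≤ (z : ℕ) → (z : ℕ) ≤ M → z ∉ I := by
    intro z h1 h2 h3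
    have := mem_leaves.1 (hI h3); omega
  simp only [splitTree, closedBroom_adj (show m < M by omega), broom, BroomRel]
  have h2 := h1 ⟨i, by omega⟩ hmi hiM.le
  have h3 := h1 ⟨i + 1, by omega⟩ (by simp only; omega) hiM
  simp only [h2, h3, or_false, true_and]
  omega

lemma mem_iff_mem_splitTree_verts (hmk : m ≤ k) (hkl : k ≤ l) (hlM : l < M)
    (hI : I ∈ (leaves m M).powerset) (x : Fin (M + 1 + m)) :
    x ∈ I ↔ x ∈ leaves m M ∧ x ∈ (splitTree m M k l I).verts := by
  rw [Finset.mem_powerset] at hI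
  refine ⟨fun hx => ⟨hI hx, Or.inr (Or.inr hx)⟩, ?_⟩
  rintro ⟨h1, h2 | h2 | h2⟩
  · rw [mem_leaves] at h1; omega
  · rw [mem_leaves] at h1; omega
  · exact h2

lemma splitTree_inj {k' l' : ℕ} {I' : Finset (Fin (M + 1 + m))} (hmk : m ≤ k) (hkl : k ≤ l)
    (hlM : l < M) (hI : I ∈ (leaves m M).powerset) (hmk' : m ≤ k') (hkl' : k' ≤ l')
    (hlM' : l' < M) (hI' : I' ∈ (leaves m M).powerset)
    (h : splitTree m M k l I = splitTree m M k' l' I') : k = k' ∧ l = l' ∧ I = I' := by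
  have h1 : ∀ i, m ≤ i → i < M → ((k ≤ i ∧ i ≤ l) ↔ (k' ≤ i ∧ i ≤ l')) := by
    intro i h1 h2
    have e1 := splitTree_adj_succ hkl hI i h1 h2
    have e2 := splitTree_adj_succ hkl' hI' i h1 h2
    rw [h, e2] at e1
    exact (not_iff_not.1 e1).symm
  have a1 := h1 k hmk (by omega)
  have a2 := h1 k' hmk' (by omega)
  have a3 := h1 l (by omega) hlM
  have a4 := h1 l' (by omega) hlM'
  refine ⟨by omega, by omega, ?_⟩
  ext x
  rw [mem_iff_mem_splitTree_verts hmk hkl hlM hI, h,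
    ← mem_iff_mem_splitTree_verts hmk' hkl' hlM' hI']

lemma ncard_splitTree_verts_le (hm : m < M) (hI : I ∈ (leaves m M).powerset) :
    (splitTree m M k l I).verts.ncard ≤ (k + 1 - m) + (M - l) + 2 * m := by
  classical
  have h1 : (splitTree m M k l I).verts ⊆ {x | (m ≤ (x : ℕ) ∧ (x : ℕ) ≤ k)} ∪
      ({x | l + 1 ≤ (x : ℕ) ∧ (x : ℕ) ≤ M} ∪ (leaves m M : Set (Fin (M + 1 + m)))) := by
    rintro x (h | h | h)
    · exact Or.inl h
    · exact Or.inr (Or.inl h)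
    · exact Or.inr (Or.inr (Finset.mem_powerset.1 hI h))
  have h2 : ∀ a b : ℕ, {x : Fin (M + 1 + m) | a ≤ (x : ℕ) ∧ (x : ℕ) ≤ b}.ncard ≤ b + 1 - a := by
    intro a b
    calc _ ≤ ((Finset.Icc a b : Finset ℕ) : Set ℕ).ncard :=
          Set.ncard_le_ncard_of_injOn Fin.val (fun x hx => by simpa using hx)
            Fin.val_injective.injOn
      _ = _ := by simp
  refine (Set.ncard_le_ncard h1 (Set.toFinite _)).trans ?_
  refine (Set.ncard_union_le _ _).trans ?_
  have h3 := Set.ncard_union_le {x : Fin (M + 1 + m) | l + 1 ≤ (x : ℕ) ∧ (x : ℕ) ≤ M}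
    (leaves m M : Set (Fin (M + 1 + m)))
  rw [Set.ncard_coe_finset, card_leaves hm] at h3
  have := h2 m k
  have := h2 (l + 1) M
  omega

end SplitTree

/-- Every subtree of the closed double broom using the added edge is a `splitTree`. -/
lemma exists_eq_splitTree {m M : ℕ} {T : (closedBroom m M).Subgraph}
    (hT : T.coe.IsTree) (huv : T.Adj ⟨m, by omega⟩ ⟨M, by omega⟩) (hM : m + 2 ≤ M) :
    ∃ k l I, m ≤ k ∧ k ≤ l ∧ l < M ∧ I ∈ (leaves m M).powerset ∧ T = splitTree m M k l I := by
  classical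
  have hconn := hT.connected
  have humem := T.edge_vert huv
  have hvmem := T.edge_vert huv.symm
  have hsub : ∀ {x y}, T.Adj x y → _ := fun {x y} h => (closedBroom_adj (by omega)).1 (T.adj_sub h)
  simp only [broom, BroomRel] at hsub
  have hllv : ∀ x ∈ T.verts, (x : ℕ) < m → T.Adj x ⟨m, by omega⟩ := by
    intro x hx hxm
    obtain ⟨a, b, hab, ha, hb⟩ := exists_adj_of_cut hconn {z | z = x} hx humem rfl
      (by simp only [Set.mem_ofPred_eq, Fin.ext_iff]; omega)
    obtain rfl : a = x := ha
    have := hsub hab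
    obtain rfl : b = ⟨m, by omega⟩ := Fin.ext (by simp only; omega)
    exact hab
  have hrlv : ∀ x ∈ T.verts, M < (x : ℕ) → T.Adj x ⟨M, by omega⟩ := by
    intro x hx hxm
    obtain ⟨a, b, hab, ha, hb⟩ := exists_adj_of_cut hconn {z | z = x} hx humem rfl
      (by simp only [Set.mem_ofPred_eq, Fin.ext_iff]; omega)
    obtain rfl : a = x := ha
    have := hsub hab
    obtain rfl : b = ⟨M, by omega⟩ := Fin.ext (by simp only; omega)
    exact hab
  have hcast : ∀ {x y x' y' : Fin (M + 1 + m)}, T.Adj x y → (x : ℕ) = x' → (y : ℕ) = y' →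
      T.Adj x' y' := by
    intro x y x' y' h h1 h2
    rwa [← Fin.ext h1, ← Fin.ext h2]
  let E : ℕ → Prop := fun i => ∃ (_ : m ≤ i) (hi : i < M),
    ¬ T.Adj ⟨i, by omega⟩ ⟨i + 1, by omega⟩
  have hE : ∃ i, E i := by
    by_contra! hno
    have hadj : ∀ i (hmi : m ≤ i) (hi : i < M), T.Adj ⟨i, by omega⟩ ⟨i + 1, by omega⟩ := by
      intro i hmi hi
      by_contra h
      exact hno i ⟨hmi, hi, h⟩
    have hmem : ∀ i (hmi : m ≤ i) (hi : i ≤ M), (⟨i, by omega⟩ : Fin (M + 1 + m)) ∈ T.verts := by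
      intro i hmi hi
      rcases hi.eq_or_lt with rfl | hlt
      · exact hvmem
      · exact T.edge_vert (hadj i hmi hlt)
    have hb := SimpleGraph.isAcyclic_iff_forall_adj_isBridge.1 hT.isAcyclic
      (v := ⟨_, humem⟩) (w := ⟨_, hvmem⟩) huv
    rw [SimpleGraph.isBridge_iff] at hb
    have hreach : ∀ j (hj : m + j ≤ M), (T.coe.deleteEdges {s(⟨_, humem⟩, ⟨_, hvmem⟩)}).Reachable
        ⟨_, humem⟩ ⟨⟨m + j, by omega⟩, hmem _ (by omega) hj⟩ := by
      intro j
      induction j with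
      | zero => exact fun _ => SimpleGraph.Reachable.refl _
      | succ j ih =>
        intro hj
        refine (ih (by omega)).trans (SimpleGraph.Adj.reachable ?_)
        rw [SimpleGraph.deleteEdges_adj]
        refine ⟨hadj (m + j) (by omega) (by omega), ?_⟩
        simp only [Set.mem_singleton_iff, Sym2.eq_iff, Subtype.mk.injEq, Fin.mk.injEq]
        omega
    refine hb ?_
    have := hreach (M - m) (by omega)
    convert this using 3
    omega
  have hgap : ∀ i j, E i → E j → ∀ z ∈ T.verts, ¬ (i < (z : ℕ) ∧ (z : ℕ) ≤ j) := by
    rintro i j ⟨hi1, hi2, hi3⟩ ⟨hj1, hj2, hj3⟩ z hz hzij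
    obtain ⟨a, b, hab, ha, hb⟩ := exists_adj_of_cut hconn {z | i < (z : ℕ) ∧ (z : ℕ) ≤ j} hz humem
      hzij (by simp only [Set.mem_ofPred_eq]; omega)
    simp only [Set.mem_ofPred_eq] at ha hb
    have h1 := hsub hab
    rcases (by omega : ((b : ℕ) = i ∧ (a : ℕ) = i + 1) ∨ ((a : ℕ) = j ∧ (b : ℕ) = j + 1))
      with ⟨h2, h3⟩ | ⟨h2, h3⟩
    · exact hi3 (hcast hab.symm h2 h3)
    · exact hj3 (hcast hab h2 h3)
  set F := (Finset.range M).filter E with hF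
  have hFE : ∀ i, i ∈ F ↔ E i := by
    intro i
    rw [hF, Finset.mem_filter, Finset.mem_range]
    exact ⟨fun h => h.2, fun h => ⟨h.2.1, h⟩⟩
  have hFne : F.Nonempty := hE.imp fun i hi => (hFE i).2 hi
  obtain ⟨k, hkE, hkmin⟩ : ∃ k, E k ∧ ∀ i, E i → k ≤ i :=
    ⟨F.min' hFne, (hFE _).1 (F.min'_mem hFne), fun i hi => F.min'_le i ((hFE i).2 hi)⟩
  obtain ⟨l, hlE, hlmax⟩ : ∃ l, E l ∧ ∀ i, E i → i ≤ l :=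
    ⟨F.max' hFne, (hFE _).1 (F.max'_mem hFne), fun i hi => F.le_max' i ((hFE i).2 hi)⟩
  have hadj : ∀ i (hmi : m ≤ i) (hi : i < M), (i < k ∨ l < i) →
      T.Adj ⟨i, by omega⟩ ⟨i + 1, by omega⟩ := by
    intro i hmi hi h
    by_contra hn
    have := hkmin i ⟨hmi, hi, hn⟩
    have := hlmax i ⟨hmi, hi, hn⟩
    omega
  have hkl := hkmin l hlE
  have hgap' := hgap k l hkE hlE
  obtain ⟨hmk, hkM, hkadj⟩ := hkE
  obtain ⟨hml, hlM, hladj⟩ := hlE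
  have hverts : ∀ x : Fin (M + 1 + m), x ∈ T.verts ↔ ((m ≤ (x : ℕ) ∧ (x : ℕ) ≤ k) ∨
      (l + 1 ≤ (x : ℕ) ∧ (x : ℕ) ≤ M) ∨ x ∈ (leaves m M).filter (· ∈ T.verts)) := by
    intro x
    rw [Finset.mem_filter, mem_leaves]
    constructor
    · intro hx
      have := hgap' x hx
      simp only [hx, and_true]
      omega
    · rintro (h | h | h)
      · rcases h.1.eq_or_lt with h1 | h1
        · exact (Fin.ext h1 : (⟨m, by omega⟩ : Fin (M + 1 + m)) = x) ▸ humem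
        · have := T.edge_vert (hadj (x - 1) (by omega) (by omega) (by omega)).symm
          convert this using 1
          exact Fin.ext (by simp only; omega)
      · rcases h.2.eq_or_lt with h1 | h1
        · exact (Fin.ext h1.symm : (⟨M, by omega⟩ : Fin (M + 1 + m)) = x) ▸ hvmem
        · exact T.edge_vert (hadj x (by omega) (by omega) (by omega))
      · exact h.2
  refine ⟨k, l, (leaves m M).filter (· ∈ T.verts), hmk, hkl, hlM,
    Finset.mem_powerset.2 (Finset.filter_subset _ _), ?_⟩
  refine SimpleGraph.Subgraph.ext (Set.ext hverts) ?_
  ext x y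
  constructor
  · intro h
    refine ⟨T.adj_sub h, (hverts x).1 (T.edge_vert h), (hverts y).1 (T.edge_vert h.symm), ?_, ?_⟩
    · exact fun hk => hkadj (hcast h hk.1 hk.2)
    · exact fun hk => hkadj (hcast h.symm hk.1 hk.2)
  · have main : ∀ x y : Fin (M + 1 + m), x ∈ T.verts → y ∈ T.verts →
        (BroomRel m M x y ∨ ((x : ℕ) = m ∧ (y : ℕ) = M)) →
        ¬ ((x : ℕ) = k ∧ (y : ℕ) = k + 1) → T.Adj x y := by
      intro x y hx hy hxy hne
      have hgx := hgap' x hx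
      have hgy := hgap' y hy
      rcases hxy with (h | h | h) | h
      · exact hcast (hllv x hx h.1) rfl h.2.symm
      · exact hcast (hadj x h.1 (by omega) (by omega)) rfl h.2.1.symm
      · exact hcast (hrlv y hy h.2).symm h.1.symm rfl
      · exact hcast huv h.1.symm h.2.symm
    rintro ⟨h1, h2, h3, h4, h5⟩
    rw [closedBroom_adj (by omega)] at h1
    have h2 := (hverts x).2 h2
    have h3 := (hverts y).2 h3
    rcases h1 with (h | h) | h | h
    · exact main x y h2 h3 (Or.inl h) h4
    · exact (main y x h3 h2 (Or.inl h) h5).symm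
    · exact main x y h2 h3 (Or.inr h) h4
    · exact (main y x h3 h2 (Or.inr h.symm) h5).symm

lemma mu_eq_sum_div_card {V : Type*} {K : SimpleGraph V} (F : Finset K.Subgraph)
    (hF : ∀ T, T ∈ F ↔ T ∈ subtrees K) :
    mu K = (∑ T ∈ F, (T.verts.ncard : ℝ)) / (F.card : ℝ) := by
  have h : subtrees K = (F : Set K.Subgraph) := by
    ext T; exact (hF T).symm
  rw [mu, numSubtrees, h, finsum_mem_coe_finset, Set.ncard_coe_finset]

lemma le_den_broom (m N : ℕ) (hN : 0 < N) :
    (4 ^ m * ((N : ℝ) + 1)) / ((4 ^ m + 2 * (m + N + 1 + m) ^ 2 * 2 ^ m) * (m + N + 1 + m)) ≤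
      den (broom m (m + N)) := by
  classical
  have hm : m < m + N := by omega
  set F : Finset (broom m (m + N)).Subgraph := (Set.toFinite (subtrees _)).toFinset with hF
  have hmem : ∀ T, T ∈ F ↔ T ∈ subtrees (broom m (m + N)) := by simp [hF]
  set A := (leaves m (m + N)).powerset.image (fullTree m (m + N)) with hA
  have hAF : A ⊆ F := by
    intro T hT
    obtain ⟨I, -, rfl⟩ := Finset.mem_image.1 hT
    exact (hmem _).2 (fullTree_isTree hm)
  have hAcard : A.card = 4 ^ m := by
    rw [hA, Finset.card_image_of_injOn (fullTree_injOn m (m + N)), card_powerset_leaves hm]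
  have hFcard : F.card ≤ 4 ^ m + 2 * (m + N + 1 + m) ^ 2 * 2 ^ m := by
    refine le_trans (le_of_eq ?_) (ncard_subtrees_in_broom_le hm (broom m (m + N)))
    rw [← Set.ncard_coe_finset]
    congr 1
    ext T
    exact ⟨fun h => ⟨(hmem T).1 h, fun x y hxy => T.adj_sub hxy⟩, fun h => (hmem T).2 h.1⟩
  have hsum : 4 ^ m * ((N : ℝ) + 1) ≤ ∑ T ∈ F, (T.verts.ncard : ℝ) := by
    calc 4 ^ m * ((N : ℝ) + 1) = ∑ T ∈ A, ((N : ℝ) + 1) := by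
          rw [Finset.sum_const, hAcard, nsmul_eq_mul]; push_cast; ring
      _ ≤ ∑ T ∈ A, (T.verts.ncard : ℝ) := by
          refine Finset.sum_le_sum fun T hT => ?_
          obtain ⟨I, -, rfl⟩ := Finset.mem_image.1 hT
          have := le_ncard_fullTree_verts I
          have h2 : N + 1 ≤ (fullTree m (m + N) I).verts.ncard := by omega
          exact_mod_cast h2
      _ ≤ _ := Finset.sum_le_sum_of_subset_of_nonneg hAF fun _ _ _ => Nat.cast_nonneg _
  have hpos : 0 < F.card := by
    have := Finset.card_le_card hAF
    have h4 : 0 < 4 ^ m := by positivity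
    omega
  rw [den, mu_eq_sum_div_card F hmem, Fintype.card_fin, div_div]
  have hFcard' : (F.card : ℝ) ≤ 4 ^ m + 2 * (m + N + 1 + m) ^ 2 * 2 ^ m := by
    exact_mod_cast hFcard
  push_cast
  have hpos' : (0 : ℝ) < F.card := by exact_mod_cast hpos
  gcongr

lemma sum_range_sum_range_gap (c : ℝ) (N : ℕ) :
    ∑ l ∈ Finset.range N, ∑ k ∈ Finset.range (l + 1), ((k : ℝ) + 1 + (c - l)) =
      N * (N + 1) * ((N + 2) / 6 + c / 2 - (N - 1) / 3) := by
  have inner : ∀ (d : ℝ) (l : ℕ), ∑ k ∈ Finset.range l, ((k : ℝ) + 1 + d) =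
      l * (l + 1) / 2 + l * d := by
    intro d l
    induction l with
    | zero => simp
    | succ l ih => rw [Finset.sum_range_succ, ih]; push_cast; ring
  simp only [inner]
  induction N with
  | zero => simp
  | succ N ih => rw [Finset.sum_range_succ, ih]; push_cast; ring

lemma den_closedBroom_le (m N : ℕ) (hN : 2 ≤ N) :
    den (closedBroom m (m + N)) ≤ (2 * ((N : ℝ) + 2) / 3 + 2 * m) / (m + N + 1 + m) +
      (4 ^ m + 2 * (m + N + 1 + m) ^ 2 * 2 ^ m) / (4 ^ m * (N * (N + 1) / 2)) := by
  classical
  have hm : m < m + N := by omega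
  set F : Finset (closedBroom m (m + N)).Subgraph := (Set.toFinite (subtrees _)).toFinset with hF
  have hmem : ∀ T, T ∈ F ↔ T ∈ subtrees (closedBroom m (m + N)) := by simp [hF]
  set P : Finset ((Σ _ : ℕ, ℕ) × Finset (Fin (m + N + 1 + m))) :=
    ((Finset.range N).sigma fun l => Finset.range (l + 1)) ×ˢ (leaves m (m + N)).powerset with hP
  set f : (Σ _ : ℕ, ℕ) × Finset (Fin (m + N + 1 + m)) → (closedBroom m (m + N)).Subgraph :=
    fun p => splitTree m (m + N) (m + p.1.2) (m + p.1.1) p.2 with hf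
  have hPmem : ∀ p, p ∈ P ↔ (p.1.1 < N ∧ p.1.2 < p.1.1 + 1) ∧ p.2 ∈ (leaves m (m + N)).powerset := by
    intro p
    simp only [hP, Finset.mem_product, Finset.mem_sigma, Finset.mem_range]
  set q : (closedBroom m (m + N)).Subgraph → Prop :=
    fun T => T.Adj ⟨m, by omega⟩ ⟨m + N, by omega⟩ with hq
  have hinj : Set.InjOn f P := by
    rintro ⟨⟨l, k⟩, I⟩ h ⟨⟨l', k'⟩, I'⟩ h' heq
    rw [Finset.mem_coe, hPmem] at h h'
    obtain ⟨h1, h2, h3⟩ := splitTree_inj (by omega) (by simp only at h ⊢; omega)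
      (by simp only at h ⊢; omega) h.2 (by omega) (by simp only at h' ⊢; omega)
      (by simp only at h' ⊢; omega) h'.2 heq
    simp only at h1 h2 h3
    obtain rfl : k = k' := by omega
    obtain rfl : l = l' := by omega
    rw [h3]
  have himage : F.filter q = P.image f := by
    ext T
    rw [Finset.mem_filter, hmem, Finset.mem_image]
    constructor
    · rintro ⟨hT, hqT⟩
      obtain ⟨k, l, I, h1, h2, h3, h4, rfl⟩ := exists_eq_splitTree hT hqT (by omega)
      refine ⟨(⟨l - m, k - m⟩, I), (hPmem _).2 ⟨⟨?_, ?_⟩, h4⟩, ?_⟩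
      · simp only; omega
      · simp only; omega
      · simp only [hf]
        rw [Nat.add_sub_cancel' h1, Nat.add_sub_cancel' (h1.trans h2)]
    · rintro ⟨p, hp, rfl⟩
      obtain ⟨⟨h1, h2⟩, h3⟩ := (hPmem p).1 hp
      exact ⟨⟨splitTree_connected (by omega) (by omega) (by omega) (by omega) h3,
        splitTree_isAcyclic (by omega) (by omega) (by omega) h3⟩,
        splitTree_adj_ends (by omega) (by omega) (by omega) (by omega)⟩
  have hPcard : (P.card : ℝ) = 4 ^ m * (N * (N + 1) / 2) := by
    rw [hP, Finset.card_product, card_powerset_leaves hm, Finset.card_sigma]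
    simp only [Finset.card_range]
    have : ∀ n : ℕ, ((∑ l ∈ Finset.range n, (l + 1) : ℕ) : ℝ) = n * (n + 1) / 2 := by
      intro n
      induction n with
      | zero => simp
      | succ n ih => rw [Finset.sum_range_succ, Nat.cast_add, ih]; push_cast; ring
    rw [Nat.cast_mul, this]
    push_cast
    ring
  have hsum1 : ∑ T ∈ F.filter q, (T.verts.ncard : ℝ) ≤
      4 ^ m * (N * (N + 1) / 2) * (2 * ((N : ℝ) + 2) / 3 + 2 * m) := by
    rw [himage, Finset.sum_image hinj]
    calc ∑ p ∈ P, ((f p).verts.ncard : ℝ) ≤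
          ∑ p ∈ P, ((p.1.2 : ℝ) + 1 + ((N + 2 * m : ℝ) - p.1.1)) := by
          refine Finset.sum_le_sum fun p hp => ?_
          obtain ⟨⟨h1, h2⟩, h3⟩ := (hPmem p).1 hp
          have h4 := ncard_splitTree_verts_le (k := m + p.1.2) (l := m + p.1.1) hm h3
          have h5 : (f p).verts.ncard + p.1.1 ≤ p.1.2 + 1 + (N + 2 * m) := by
            simp only [hf]; omega
          have h6 : ((f p).verts.ncard : ℝ) + p.1.1 ≤ p.1.2 + 1 + (N + 2 * m) := by
            exact_mod_cast h5
          linarith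
      _ = _ := by
          rw [hP, Finset.sum_product]
          simp only [Finset.sum_const, card_powerset_leaves hm, nsmul_eq_mul]
          rw [← Finset.mul_sum, Finset.sum_sigma, sum_range_sum_range_gap]
          push_cast
          ring
  have hcard2 : ((F.filter fun T => ¬ q T).card : ℝ) ≤
      4 ^ m + 2 * (m + N + 1 + m) ^ 2 * 2 ^ m := by
    have : (F.filter fun T => ¬ q T).card ≤ 4 ^ m + 2 * (m + N + 1 + m) ^ 2 * 2 ^ m := by
      refine le_trans ?_ (ncard_subtrees_in_broom_le hm (closedBroom m (m + N)))
      rw [← Set.ncard_coe_finset]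
      refine Set.ncard_le_ncard ?_ (Set.toFinite _)
      intro T hT
      rw [Finset.mem_coe, Finset.mem_filter, hmem] at hT
      refine ⟨hT.1, fun x y hxy => ?_⟩
      rcases (closedBroom_adj hm).1 (T.adj_sub hxy) with h | h | h
      · exact h
      · have hx : x = ⟨m, by clear h; omega⟩ := Fin.ext h.1
        have hy : y = ⟨m + N, by clear h; omega⟩ := Fin.ext h.2
        rw [hx, hy] at hxy
        exact absurd hxy hT.2
      · have hx : x = ⟨m + N, by clear h; omega⟩ := Fin.ext h.1
        have hy : y = ⟨m, by clear h; omega⟩ := Fin.ext h.2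
        rw [hx, hy] at hxy
        exact absurd hxy.symm hT.2
    exact_mod_cast this
  have hsum2 : ∑ T ∈ F.filter (fun T => ¬ q T), (T.verts.ncard : ℝ) ≤
      (4 ^ m + 2 * (m + N + 1 + m) ^ 2 * 2 ^ m) * (m + N + 1 + m) := by
    calc _ ≤ ∑ T ∈ F.filter (fun T => ¬ q T), ((m : ℝ) + N + 1 + m) := by
          refine Finset.sum_le_sum fun T _ => ?_
          have : T.verts.ncard ≤ m + N + 1 + m := by
            simpa using Set.ncard_le_card T.verts
          exact_mod_cast this
      _ = (F.filter fun T => ¬ q T).card * ((m : ℝ) + N + 1 + m) := by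
          rw [Finset.sum_const, nsmul_eq_mul]
      _ ≤ _ := by gcongr
  have hcardF : 4 ^ m * (N * (N + 1) / 2) ≤ (F.card : ℝ) := by
    rw [← hPcard, ← Finset.card_image_of_injOn hinj, ← himage]
    exact_mod_cast Finset.card_filter_le _ _
  have hNpos : (0 : ℝ) < N := by exact_mod_cast (by omega : 0 < N)
  rw [den, mu_eq_sum_div_card F hmem, Fintype.card_fin, div_div,
    ← Finset.sum_filter_add_sum_filter_not F q]
  push_cast
  set D : ℝ := 4 ^ m + 2 * (m + N + 1 + m) ^ 2 * 2 ^ m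
  set Q : ℝ := 4 ^ m * (N * (N + 1) / 2) with hQ
  have hQpos : 0 < Q := by positivity
  have hnpos : (0 : ℝ) < m + N + 1 + m := by positivity
  calc _ ≤ (Q * (2 * ((N : ℝ) + 2) / 3 + 2 * m) + D * (m + N + 1 + m)) /
        (Q * (m + N + 1 + m)) := by gcongr
    _ = _ := by field_simp

lemma broom_connected {m M : ℕ} (hm : m < M) : (broom m M).Connected := by
  have h := (fullTree_isTree hm (I := Finset.univ)).connected
  refine SimpleGraph.connected_iff_exists_forall_reachable _ |>.2 ⟨⟨m, by omega⟩, fun x => ?_⟩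
  obtain ⟨p⟩ := h.preconnected ⟨⟨m, by omega⟩, Or.inr (Finset.mem_univ _)⟩
    ⟨x, Or.inr (Finset.mem_univ _)⟩
  exact ⟨p.map (fullTree m M Finset.univ).hom⟩

lemma tendsto_density_gap : Tendsto (fun m : ℕ =>
    (1 - 2 * (1 / ((m : ℝ) + 1)) + 2 * (1 / ((m : ℝ) + 1)) ^ 2) /
        (1 + 2 * (((m + 1 : ℕ) : ℝ) ^ 4 / 2 ^ m)) -
      (2 / 3 * (1 + 1 / ((m : ℝ) + 1)) +
        (1 + 2 * (((m + 1 : ℕ) : ℝ) ^ 4 / 2 ^ m)) * (2 * (1 / ((m : ℝ) + 1)))))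
    atTop (𝓝 (1 / 3)) := by
  have ha : Tendsto (fun m : ℕ => 1 / ((m : ℝ) + 1)) atTop (𝓝 0) :=
    tendsto_one_div_add_atTop_nhds_zero_nat
  have hq : Tendsto (fun m : ℕ => ((m + 1 : ℕ) : ℝ) ^ 4 / 2 ^ m) atTop (𝓝 0) := by
    have h1 := (tendsto_pow_const_div_const_pow_of_one_lt 4 (one_lt_two (α := ℝ))).comp
      (tendsto_add_atTop_nat 1)
    have h2 := h1.const_mul 2
    rw [mul_zero] at h2
    refine h2.congr fun m => ?_
    simp only [Function.comp_apply, pow_succ (2 : ℝ) m]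
    field_simp
  have h1q := (hq.const_mul 2).const_add 1
  have h := (((ha.const_mul 2).const_sub 1).add ((ha.pow 2).const_mul 2)).div h1q (by norm_num)
  have h' := h.sub (((ha.const_add 1).const_mul (2 / 3)).add (h1q.mul (ha.const_mul 2)))
  norm_num at h' ⊢
  exact h'

/-- Adding a single edge between two nonadjacent vertices of a connected graph can
decrease the density by an amount arbitrarily close to `1/3`. -/
theorem edge_addition_can_decrease_density_by_almost_third :
    ∀ ε : ℝ, 0 < ε →
      ∃ (n : ℕ) (G : SimpleGraph (Fin n)) (u v : Fin n),
        G.Connected ∧ u ≠ v ∧ ¬ G.Adj u v ∧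
          den G - den (addEdge G u v) > 1 / 3 - ε := by
  intro ε hε
  obtain ⟨m, hgap, hm⟩ := ((tendsto_density_gap.eventually
    (lt_mem_nhds (by linarith : 1 / 3 - ε < 1 / 3))).and (eventually_ge_atTop 2)).exists
  have hmm : 4 ≤ m ^ 2 := by nlinarith
  refine ⟨m + m ^ 2 + 1 + m, broom m (m + m ^ 2), ⟨m, by omega⟩, ⟨m + m ^ 2, by omega⟩,
    broom_connected (by omega), ?_, ?_, ?_⟩
  · simp only [ne_eq, Fin.mk.injEq]; omega
  · simp only [broom, BroomRel]; omega
  refine hgap.trans_le (sub_le_sub ((le_of_eq ?_).trans (le_den_broom m (m ^ 2) (by omega)))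
    ((den_closedBroom_le m (m ^ 2) (by omega)).trans ?_))
  · have h4 : (4 : ℝ) ^ m = 2 ^ m * 2 ^ m := by rw [← mul_pow]; norm_num
    rw [h4]
    have h2 : (2 : ℝ) ^ m ≠ 0 := by positivity
    have h3 : (m : ℝ) + 1 ≠ 0 := by positivity
    push_cast
    rw [show (m : ℝ) + m ^ 2 + 1 + m = (m + 1) ^ 2 by ring]
    field_simp
    ring
  · have h4 : (4 : ℝ) ^ m = 2 ^ m * 2 ^ m := by rw [← mul_pow]; norm_num
    rw [h4]
    have h2 : (2 : ℝ) ^ m ≠ 0 := by positivity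
    have h3 : (m : ℝ) + 1 ≠ 0 := by positivity
    have hm' : (2 : ℝ) ≤ m := by exact_mod_cast hm
    push_cast
    rw [show (m : ℝ) + m ^ 2 + 1 + m = (m + 1) ^ 2 by ring]
    refine add_le_add (le_of_eq ?_) ?_
    · field_simp
      ring
    · have e1 : ((2 : ℝ) ^ m * 2 ^ m + 2 * (((m : ℝ) + 1) ^ 2) ^ 2 * 2 ^ m) /
          (2 ^ m * 2 ^ m * (m ^ 2 * (m ^ 2 + 1) / 2)) =
          (1 + 2 * (((m : ℝ) + 1) ^ 4 / 2 ^ m)) * (2 * (1 / (m ^ 2 * (m ^ 2 + 1)))) := by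
        field_simp
      rw [e1]
      gcongr
      nlinarith [sq_nonneg ((m : ℝ)), mul_nonneg (sq_nonneg (m : ℝ)) (sq_nonneg (m : ℝ))]

end SubtreePaper
end
end

section
/- For every tree T of order n ≥ 3, there exist two distinct nonadjacent vertices u and v of T such that the graph H obtained from T by adding the edge uv satisfies μ(H) > μ(T). -/
open Filter Topology

noncomputable section

namespace SubtreePaper

section Helpers

open scoped Classical
open Relation Finset

variable {V : Type*}

/-- A finite vertex set is connected in `G` if it is nonempty and any two of its vertices are
joined by a walk of `G` that stays in it. -/
def IsConnSet (G : SimpleGraph V) (S : Finset V) : Prop :=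
  S.Nonempty ∧ ∀ x ∈ S, ∀ y ∈ S, ReflTransGen (fun a b => G.Adj a b ∧ a ∈ S ∧ b ∈ S) x y

/-- `A` and `B` are disjoint, and `wb` is the only edge of `G` between them. -/
structure IsSplit (G : SimpleGraph V) (A B : Finset V) (w b : V) : Prop where
  disjoint : Disjoint A B
  left_mem : w ∈ A
  right_mem : b ∈ B
  adj : G.Adj w b
  only : ∀ x ∈ A, ∀ y ∈ B, G.Adj x y → x = w ∧ y = b

lemma IsSplit.symm {G : SimpleGraph V} {A B : Finset V} {w b : V} (h : IsSplit G A B w b) :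
    IsSplit G B A b w :=
  ⟨h.disjoint.symm, h.right_mem, h.left_mem, h.adj.symm,
    fun x hx y hy hxy => (h.only y hy x hx hxy.symm).symm⟩

lemma isConnSet_singleton (G : SimpleGraph V) (w : V) : IsConnSet G {w} := by
  refine ⟨singleton_nonempty w, fun x hx y hy => ?_⟩
  rw [mem_singleton] at hx hy
  rw [hx, hy]

lemma IsConnSet.congr {G G' : SimpleGraph V} {S : Finset V}
    (h : ∀ x ∈ S, ∀ y ∈ S, G.Adj x y → G'.Adj x y) (hS : IsConnSet G S) : IsConnSet G' S :=
  ⟨hS.1, fun x hx y hy => ReflTransGen.mono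
    (fun a b hab => ⟨h a hab.2.1 b hab.2.2 hab.1, hab.2⟩) x y (hS.2 x hx y hy)⟩

/-- A set containing a vertex reachable from a chosen one and missing another is left by an
edge. -/
lemma exists_rel_of_reflTransGen {α : Type*} {r : α → α → Prop} {x y : α} (h : ReflTransGen r x y)
    (p : α → Prop) (hx : p x) (hy : ¬ p y) : ∃ a b, r a b ∧ p a ∧ ¬ p b := by
  induction h with
  | refl => exact absurd hx hy
  | @tail b c _ hbc ih =>
    by_cases hb : p b
    · exact ⟨b, c, hbc, hb, hy⟩
    · exact ih hb

lemma IsConnSet.union {G : SimpleGraph V} {S S' : Finset V} {w b : V} (hS : IsConnSet G S)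
    (hS' : IsConnSet G S') (hw : w ∈ S) (hb : b ∈ S') (h : G.Adj w b) :
    IsConnSet G (S ∪ S') := by
  have h1 : ∀ x ∈ S, ∀ y ∈ S,
      ReflTransGen (fun a b => G.Adj a b ∧ a ∈ S ∪ S' ∧ b ∈ S ∪ S') x y := fun x hx y hy =>
    ReflTransGen.mono (fun a b hab =>
      ⟨hab.1, mem_union_left _ hab.2.1, mem_union_left _ hab.2.2⟩) x y (hS.2 x hx y hy)
  have h2 : ∀ x ∈ S', ∀ y ∈ S',
      ReflTransGen (fun a b => G.Adj a b ∧ a ∈ S ∪ S' ∧ b ∈ S ∪ S') x y := fun x hx y hy =>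
    ReflTransGen.mono (fun a b hab =>
      ⟨hab.1, mem_union_right _ hab.2.1, mem_union_right _ hab.2.2⟩) x y (hS'.2 x hx y hy)
  have hwb : ReflTransGen (fun a b => G.Adj a b ∧ a ∈ S ∪ S' ∧ b ∈ S ∪ S') w b :=
    .single ⟨h, mem_union_left _ hw, mem_union_right _ hb⟩
  have hbw : ReflTransGen (fun a b => G.Adj a b ∧ a ∈ S ∪ S' ∧ b ∈ S ∪ S') b w :=
    .single ⟨h.symm, mem_union_right _ hb, mem_union_left _ hw⟩
  refine ⟨⟨w, mem_union_left _ hw⟩, fun x hx y hy => ?_⟩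
  rcases mem_union.1 hx with hx | hx <;> rcases mem_union.1 hy with hy | hy
  · exact h1 x hx y hy
  · exact ((h1 x hx w hw).trans hwb).trans (h2 b hb y hy)
  · exact ((h2 x hx b hb).trans hbw).trans (h1 w hw y hy)
  · exact h2 x hx y hy

/-- A connected set meeting both sides of a split contains the splitting edge. -/
lemma IsSplit.mem_of_mem {G : SimpleGraph V} {A B S : Finset V} {w b x y : V}
    (h : IsSplit G A B w b) (hS : IsConnSet G S) (hSAB : S ⊆ A ∪ B) (hx : x ∈ S) (hxA : x ∈ A)
    (hy : y ∈ S) (hyB : y ∈ B) : w ∈ S ∧ b ∈ S := by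
  obtain ⟨c, d, ⟨hcd, hcS, hdS⟩, hc, hd⟩ :=
    exists_rel_of_reflTransGen (hS.2 x hx y hy) (· ∈ A) hxA
      (fun hyA => (Finset.disjoint_left.1 h.disjoint) hyA hyB)
  have hdB : d ∈ B := (mem_union.1 (hSAB hdS)).resolve_left hd
  obtain ⟨rfl, rfl⟩ := h.only c hc d hdB hcd
  exact ⟨hcS, hdS⟩

lemma IsSplit.isConnSet_inter {G : SimpleGraph V} {A B S : Finset V} {w b : V}
    (h : IsSplit G A B w b) (hS : IsConnSet G S) (hSAB : S ⊆ A ∪ B) (hw : w ∈ S) :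
    IsConnSet G (S ∩ A) := by
  refine ⟨⟨w, mem_inter.2 ⟨hw, h.left_mem⟩⟩, fun x hx y hy => ?_⟩
  rw [mem_inter] at hx hy
  have key := ReflTransGen.lift' (p := fun a b => G.Adj a b ∧ a ∈ S ∩ A ∧ b ∈ S ∩ A)
    (fun z => if z ∈ A then z else w) ?_ x y (hS.2 x hx.1 y hy.1)
  · simpa [Function.onFun, hx.2, hy.2] using key
  · rintro c d ⟨hcd, hc, hd⟩
    simp only [Function.onFun]
    by_cases hcA : c ∈ A <;> by_cases hdA : d ∈ A
    · rw [if_pos hcA, if_pos hdA]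
      exact .single ⟨hcd, mem_inter.2 ⟨hc, hcA⟩, mem_inter.2 ⟨hd, hdA⟩⟩
    · have hdB := (mem_union.1 (hSAB hd)).resolve_left hdA
      rw [if_pos hcA, if_neg hdA, (h.only c hcA d hdB hcd).1]
    · have hcB := (mem_union.1 (hSAB hc)).resolve_left hcA
      rw [if_neg hcA, if_pos hdA, (h.only d hdA c hcB hcd.symm).1]
    · rw [if_neg hcA, if_neg hdA]

/-- The connected subsets of `C` that contain `w`. -/
def rooted (G : SimpleGraph V) (C : Finset V) (w : V) : Finset (Finset V) :=
  {S ∈ C.powerset | IsConnSet G S ∧ w ∈ S}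

/-- The connected subsets of `C` that do not contain `w`. -/
def unrooted (G : SimpleGraph V) (C : Finset V) (w : V) : Finset (Finset V) :=
  {S ∈ C.powerset | IsConnSet G S ∧ w ∉ S}

lemma mem_rooted {G : SimpleGraph V} {C S : Finset V} {w : V} :
    S ∈ rooted G C w ↔ S ⊆ C ∧ IsConnSet G S ∧ w ∈ S := by
  simp [rooted]

lemma mem_unrooted {G : SimpleGraph V} {C S : Finset V} {w : V} :
    S ∈ unrooted G C w ↔ S ⊆ C ∧ IsConnSet G S ∧ w ∉ S := by
  simp [unrooted]

lemma rooted_singleton (G : SimpleGraph V) (w : V) : rooted G {w} w = {{w}} := by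
  ext S
  rw [mem_rooted, mem_singleton]
  constructor
  · rintro ⟨h1, -, h2⟩
    exact Subset.antisymm h1 (singleton_subset_iff.2 h2)
  · rintro rfl
    exact ⟨Subset.rfl, isConnSet_singleton G w, mem_singleton_self w⟩

lemma unrooted_singleton (G : SimpleGraph V) (w : V) : unrooted G {w} w = ∅ := by
  ext S
  rw [mem_unrooted]
  constructor
  · rintro ⟨h1, h3, h2⟩
    obtain ⟨x, hx⟩ := h3.1
    have := mem_singleton.1 (h1 hx)
    exact absurd (this ▸ hx) h2
  · simp

lemma rooted_congr {G G' : SimpleGraph V} {C : Finset V} {w : V}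
    (h : ∀ x ∈ C, ∀ y ∈ C, G.Adj x y ↔ G'.Adj x y) : rooted G C w = rooted G' C w := by
  ext S
  rw [mem_rooted, mem_rooted]
  refine and_congr_right fun hS => and_congr_left fun _ => ⟨?_, ?_⟩
  · exact IsConnSet.congr fun x hx y hy => (h x (hS hx) y (hS hy)).1
  · exact IsConnSet.congr fun x hx y hy => (h x (hS hx) y (hS hy)).2

lemma IsSplit.sum_both {G : SimpleGraph V} {A B : Finset V} {w b : V} (h : IsSplit G A B w b)
    (f : Finset V → ℝ) :
    ∑ S ∈ rooted G (A ∪ B) w with b ∈ S, f S =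
      ∑ S ∈ rooted G A w, ∑ S' ∈ rooted G B b, f (S ∪ S') := by
  rw [← sum_product']
  have hU : ∀ S ⊆ A ∪ B, S ∩ A ∪ S ∩ B = S := fun S hS => by
    rw [← inter_union_distrib_left, inter_eq_left.2 hS]
  have hd := Finset.disjoint_left.1 h.disjoint
  refine sum_nbij' (fun S => (S ∩ A, S ∩ B)) (fun p => p.1 ∪ p.2) ?_ ?_ ?_ ?_ ?_
  · intro S hS
    rw [mem_filter, mem_rooted] at hS
    obtain ⟨⟨hS, hc, hw⟩, hb⟩ := hS
    rw [mem_product, mem_rooted, mem_rooted]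
    exact ⟨⟨inter_subset_right, h.isConnSet_inter hc hS hw, mem_inter.2 ⟨hw, h.left_mem⟩⟩,
      inter_subset_right, h.symm.isConnSet_inter hc (union_comm A B ▸ hS) hb,
      mem_inter.2 ⟨hb, h.right_mem⟩⟩
  · rintro ⟨S, S'⟩ hS
    rw [mem_product, mem_rooted, mem_rooted] at hS
    obtain ⟨⟨h1, h2, h3⟩, h4, h5, h6⟩ := hS
    rw [mem_filter, mem_rooted]
    exact ⟨⟨union_subset_union h1 h4, h2.union h5 h3 h6 h.adj, mem_union_left _ h3⟩,
      mem_union_right _ h6⟩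
  · intro S hS
    rw [mem_filter, mem_rooted] at hS
    exact hU S hS.1.1
  · rintro ⟨S, S'⟩ hS
    rw [mem_product, mem_rooted, mem_rooted] at hS
    obtain ⟨⟨h1, -⟩, h4, -⟩ := hS
    simp only at h1 h4
    have e1 : (S ∪ S') ∩ A = S := by
      ext x
      simp only [mem_inter, mem_union]
      exact ⟨fun hx => hx.1.resolve_right fun h' => hd hx.2 (h4 h'), fun hx => ⟨.inl hx, h1 hx⟩⟩
    have e2 : (S ∪ S') ∩ B = S' := by
      ext x
      simp only [mem_inter, mem_union]
      exact ⟨fun hx => hx.1.resolve_left fun h' => hd (h1 h') hx.2, fun hx => ⟨.inr hx, h4 hx⟩⟩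
    simp only [e1, e2]
  · intro S hS
    rw [mem_filter, mem_rooted] at hS
    simp only [hU S hS.1.1]

lemma IsSplit.sum_rooted {G : SimpleGraph V} {A B : Finset V} {w b : V} (h : IsSplit G A B w b)
    (f : Finset V → ℝ) :
    ∑ S ∈ rooted G (A ∪ B) w, f S =
      ∑ S ∈ rooted G A w, f S + ∑ S ∈ rooted G A w, ∑ S' ∈ rooted G B b, f (S ∪ S') := by
  rw [← h.sum_both, ← sum_filter_not_add_sum_filter _ (fun S => b ∈ S)]
  congr 2
  ext S
  rw [mem_filter, mem_rooted, mem_rooted]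
  constructor
  · rintro ⟨⟨h1, h2, h3⟩, h4⟩
    refine ⟨fun x hx => (mem_union.1 (h1 hx)).resolve_right fun hxB => h4 ?_, h2, h3⟩
    exact (h.mem_of_mem h2 h1 h3 h.left_mem hx hxB).2
  · rintro ⟨h1, h2, h3⟩
    exact ⟨⟨h1.trans subset_union_left, h2, h3⟩,
      fun hb => Finset.disjoint_left.1 h.disjoint (h1 hb) h.right_mem⟩

lemma IsSplit.sum_unrooted {G : SimpleGraph V} {A B : Finset V} {w b : V}
    (h : IsSplit G A B w b) (f : Finset V → ℝ) :
    ∑ S ∈ unrooted G (A ∪ B) w, f S =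
      ∑ S ∈ unrooted G A w, f S + ∑ S ∈ rooted G B b, f S + ∑ S ∈ unrooted G B b, f S := by
  have hd := Finset.disjoint_left.1 h.disjoint
  have h1 : Disjoint (unrooted G A w) (rooted G B b) := by
    refine Finset.disjoint_left.2 fun S hS hS' => ?_
    rw [mem_unrooted] at hS
    rw [mem_rooted] at hS'
    exact hd (hS.1 hS'.2.2) h.right_mem
  have h2 : Disjoint (unrooted G A w ∪ rooted G B b) (unrooted G B b) := by
    refine Finset.disjoint_left.2 fun S hS hS' => ?_
    rw [mem_union, mem_unrooted, mem_rooted] at hS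
    rw [mem_unrooted] at hS'
    rcases hS with hS | hS
    · obtain ⟨x, hx⟩ := hS.2.1.1
      exact hd (hS.1 hx) (hS'.1 hx)
    · exact hS'.2.2 hS.2.2
  rw [← sum_union h1, ← sum_union h2]
  congr 1
  ext S
  simp only [mem_union, mem_unrooted, mem_rooted]
  constructor
  · rintro ⟨hS, hc, hw⟩
    by_cases hA : ∃ x ∈ S, x ∈ A
    · obtain ⟨x, hx, hxA⟩ := hA
      refine .inl (.inl ⟨fun y hy => (mem_union.1 (hS hy)).resolve_right fun hyB => hw ?_, hc, hw⟩)
      exact (h.mem_of_mem hc hS hx hxA hy hyB).1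
    · push Not at hA
      have hSB : S ⊆ B := fun y hy => (mem_union.1 (hS hy)).resolve_left (hA y hy)
      by_cases hb : b ∈ S
      · exact .inl (.inr ⟨hSB, hc, hb⟩)
      · exact .inr ⟨hSB, hc, hb⟩
  · rintro ((⟨hS, hc, hw⟩ | ⟨hS, hc, hb⟩) | ⟨hS, hc, hb⟩)
    · exact ⟨hS.trans subset_union_left, hc, hw⟩
    · exact ⟨hS.trans subset_union_right, hc, fun hw => hd h.left_mem (hS hw)⟩
    · exact ⟨hS.trans subset_union_right, hc, fun hw => hd h.left_mem (hS hw)⟩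

/-- `IsBuilt G C w`: the set `C`, rooted at `w`, is obtained from single vertices by repeatedly
joining two rooted sets along an edge between their roots. -/
inductive IsBuilt (G : SimpleGraph V) : Finset V → V → Prop
  | single (w : V) : IsBuilt G {w} w
  | join {A B : Finset V} {w b : V} (hA : IsBuilt G A w) (hB : IsBuilt G B b)
      (h : IsSplit G A B w b) : IsBuilt G (A ∪ B) w

lemma IsBuilt.isConnSet {G : SimpleGraph V} {C : Finset V} {w : V} (h : IsBuilt G C w) :
    IsConnSet G C := by
  induction h with
  | single w => exact isConnSet_singleton G w
  | join _ _ h ihA ihB => exact ihA.union ihB h.left_mem h.right_mem h.adj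

/-- A built set stays built when a pendant vertex is attached anywhere. -/
lemma IsBuilt.insert {G : SimpleGraph V} {C : Finset V} {w l p : V} (h : IsBuilt G C w)
    (hl : l ∉ C) (hp : p ∈ C) (hpl : G.Adj p l) (honly : ∀ x ∈ C, G.Adj x l → x = p) :
    IsBuilt G (insert l C) w := by
  induction h with
  | single w =>
    obtain rfl := mem_singleton.1 hp
    have : IsSplit G {p} {l} p l := by
      refine ⟨?_, mem_singleton_self p, mem_singleton_self l, hpl, fun x hx y hy _ => ?_⟩
      · rw [disjoint_singleton]
        exact hpl.ne
      · exact ⟨mem_singleton.1 hx, mem_singleton.1 hy⟩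
    rw [show Insert.insert l ({p} : Finset V) = {p} ∪ {l} by rw [union_comm]; rfl]
    exact .join (.single p) (.single l) this
  | @join A B w b hA hB h ihA ihB =>
    rw [mem_union, not_or] at hl
    have hd := Finset.disjoint_left.1 h.disjoint
    rcases mem_union.1 hp with hpA | hpB
    · rw [← insert_union]
      refine .join (ihA hl.1 hpA fun x hx => honly x (mem_union_left _ hx)) hB
        ⟨?_, mem_insert_of_mem h.left_mem, h.right_mem, h.adj, fun x hx y hy hxy => ?_⟩
      · exact disjoint_insert_left.2 ⟨hl.2, h.disjoint⟩
      · rcases mem_insert.1 hx with rfl | hx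
        · obtain rfl := honly y (mem_union_right _ hy) hxy.symm
          exact absurd hy (hd hpA)
        · exact h.only x hx y hy hxy
    · rw [← union_insert]
      refine .join hA (ihB hl.2 hpB fun x hx => honly x (mem_union_right _ hx))
        ⟨?_, h.left_mem, mem_insert_of_mem h.right_mem, h.adj, fun x hx y hy hxy => ?_⟩
      · exact disjoint_insert_right.2 ⟨hl.1, h.disjoint⟩
      · rcases mem_insert.1 hy with rfl | hy
        · obtain rfl := honly x (mem_union_left _ hx) hxy
          exact absurd hpB (hd hx)
        · exact h.only x hx y hy hxy

/-- The number of members of a family of vertex sets. -/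
def cnt (F : Finset (Finset V)) : ℝ := ∑ _S ∈ F, 1

/-- The total size of the members of a family of vertex sets. -/
def tot (F : Finset (Finset V)) : ℝ := ∑ S ∈ F, (#S : ℝ)

lemma cnt_nonneg (F : Finset (Finset V)) : 0 ≤ cnt F := sum_nonneg fun _ _ => zero_le_one

lemma tot_nonneg (F : Finset (Finset V)) : 0 ≤ tot F := sum_nonneg fun _ _ => Nat.cast_nonneg _

lemma sum_sum_one (F F' : Finset (Finset V)) :
    ∑ _S ∈ F, ∑ _S' ∈ F', (1 : ℝ) = cnt F * cnt F' := by
  simp [cnt]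

lemma IsSplit.sum_sum_card {G : SimpleGraph V} {A B : Finset V} {w b : V}
    (h : IsSplit G A B w b) {w' b' : V} :
    ∑ S ∈ rooted G A w', ∑ S' ∈ rooted G B b', (#(S ∪ S') : ℝ) =
      tot (rooted G A w') * cnt (rooted G B b') + cnt (rooted G A w') * tot (rooted G B b') := by
  have key : ∀ S ∈ rooted G A w', ∑ S' ∈ rooted G B b', (#(S ∪ S') : ℝ) =
      #S * cnt (rooted G B b') + tot (rooted G B b') := by
    intro S hS
    rw [cnt, tot, mul_sum, ← sum_add_distrib]
    refine sum_congr rfl fun S' hS' => ?_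
    rw [card_union_of_disjoint (h.disjoint.mono (mem_rooted.1 hS).1 (mem_rooted.1 hS').1)]
    push_cast
    ring
  rw [sum_congr rfl key, sum_add_distrib, ← sum_mul]
  congr 1
  simp [cnt]

lemma IsSplit.cnt_rooted {G : SimpleGraph V} {A B : Finset V} {w b : V} (h : IsSplit G A B w b) :
    cnt (rooted G (A ∪ B) w) =
      cnt (rooted G A w) + cnt (rooted G A w) * cnt (rooted G B b) := by
  rw [← sum_sum_one]
  exact h.sum_rooted _

lemma IsSplit.tot_rooted {G : SimpleGraph V} {A B : Finset V} {w b : V} (h : IsSplit G A B w b) :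
    tot (rooted G (A ∪ B) w) = tot (rooted G A w) +
      (tot (rooted G A w) * cnt (rooted G B b) + cnt (rooted G A w) * tot (rooted G B b)) := by
  rw [← h.sum_sum_card]
  exact h.sum_rooted _

lemma IsSplit.cnt_unrooted {G : SimpleGraph V} {A B : Finset V} {w b : V}
    (h : IsSplit G A B w b) : cnt (unrooted G (A ∪ B) w) =
      cnt (unrooted G A w) + cnt (rooted G B b) + cnt (unrooted G B b) :=
  h.sum_unrooted _

lemma IsSplit.tot_unrooted {G : SimpleGraph V} {A B : Finset V} {w b : V}
    (h : IsSplit G A B w b) : tot (unrooted G (A ∪ B) w) =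
      tot (unrooted G A w) + tot (rooted G B b) + tot (unrooted G B b) :=
  h.sum_unrooted _

lemma cnt_rooted_singleton (G : SimpleGraph V) (w : V) : cnt (rooted G {w} w) = 1 := by
  simp [cnt, rooted_singleton]

lemma tot_rooted_singleton (G : SimpleGraph V) (w : V) : tot (rooted G {w} w) = 1 := by
  simp [tot, rooted_singleton]

lemma cnt_unrooted_singleton (G : SimpleGraph V) (w : V) : cnt (unrooted G {w} w) = 0 := by
  simp [cnt, unrooted_singleton]

lemma tot_unrooted_singleton (G : SimpleGraph V) (w : V) : tot (unrooted G {w} w) = 0 := by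
  simp [tot, unrooted_singleton]

lemma one_le_cnt_rooted (G : SimpleGraph V) {C : Finset V} {w : V} (hw : w ∈ C) :
    1 ≤ cnt (rooted G C w) := by
  have : 1 ≤ #(rooted G C w) := card_pos.2 ⟨{w}, mem_rooted.2
    ⟨singleton_subset_iff.2 hw, isConnSet_singleton G w, mem_singleton_self w⟩⟩
  simpa [cnt] using this

lemma cnt_rooted_le_tot_rooted (G : SimpleGraph V) (C : Finset V) (w : V) :
    cnt (rooted G C w) ≤ tot (rooted G C w) := by
  refine sum_le_sum fun S hS => ?_
  exact_mod_cast card_pos.2 ⟨w, (mem_rooted.1 hS).2.2⟩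

/-- In a built set, the mean size of the connected subsets containing the root is at most their
number. -/
lemma IsBuilt.tot_rooted_le {G : SimpleGraph V} {C : Finset V} {w : V} (h : IsBuilt G C w) :
    tot (rooted G C w) ≤ cnt (rooted G C w) ^ 2 := by
  induction h with
  | single w => simp [cnt_rooted_singleton, tot_rooted_singleton]
  | @join A B w b hA hB h ihA ihB =>
    rw [h.cnt_rooted, h.tot_rooted]
    have ha := one_le_cnt_rooted G h.left_mem
    have hb := one_le_cnt_rooted G h.right_mem
    set a := cnt (rooted G A w)
    set c := cnt (rooted G B b)
    set r := tot (rooted G A w)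
    set q := tot (rooted G B b)
    have h1 : r * (1 + c) ≤ a ^ 2 * (1 + c) := by gcongr
    have h2 : a * q ≤ a * c ^ 2 := by gcongr
    have h3 : a * c ^ 2 ≤ a ^ 2 * c ^ 2 := by
      have : a ≤ a ^ 2 := by nlinarith
      gcongr
    have h4 : 0 ≤ a ^ 2 * c := by positivity
    nlinarith

/-- Jamison's inequality: the connected subsets avoiding the root of a built set are on average no
larger than those containing it. -/
lemma IsBuilt.tot_unrooted_mul_le {G : SimpleGraph V} {C : Finset V} {w : V}
    (h : IsBuilt G C w) : tot (unrooted G C w) * cnt (rooted G C w) ≤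
      tot (rooted G C w) * cnt (unrooted G C w) := by
  induction h with
  | single w => simp [tot_unrooted_singleton, cnt_unrooted_singleton]
  | @join A B w b hA hB h ihA ihB =>
    rw [h.cnt_rooted, h.tot_rooted, h.cnt_unrooted, h.tot_unrooted]
    have ha := one_le_cnt_rooted G h.left_mem
    have hb := one_le_cnt_rooted G h.right_mem
    have har := cnt_rooted_le_tot_rooted G A w
    have hq := hB.tot_rooted_le
    have hx := cnt_nonneg (unrooted G A w)
    have hy := cnt_nonneg (unrooted G B b)
    have hq0 := tot_nonneg (rooted G B b)
    have hr0 := tot_nonneg (rooted G A w)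
    set a := cnt (rooted G A w)
    set c := cnt (rooted G B b)
    set r := tot (rooted G A w)
    set q := tot (rooted G B b)
    set x := cnt (unrooted G A w)
    set s := tot (unrooted G A w)
    set y := cnt (unrooted G B b)
    set t := tot (unrooted G B b)
    have ht : t ≤ c * y := by
      have : t * c ≤ c * y * c := ihB.trans (by nlinarith)
      exact le_of_mul_le_mul_right this (by linarith)
    have h1 : s * a * (1 + c) ≤ r * x * (1 + c) := by gcongr
    have h2 : a * q ≤ r * c ^ 2 := by gcongr
    have h3 : a * (t * c) ≤ a * (q * y) := by gcongr
    have h4 : t * a ≤ c * y * a := by gcongr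
    have h5 : c * y * a ≤ c * y * r := by gcongr
    have h6 : 0 ≤ a * q * x := by positivity
    have h7 : 0 ≤ r * y := by positivity
    have h8 : 0 ≤ r * c := by positivity
    linarith [h1, h2, h3, h4, h5, h6, h7, h8]

/-- Given a pendant vertex `u` of a tree attached to `w`, and another neighbour `v` of `w`, the
remaining vertices split along `wv` into two built sets. -/
lemma exists_isBuilt_isSplit [Fintype V] {T : SimpleGraph V} (hT : T.IsTree) {u v w : V}
    (huw : T.Adj u w) (hu : ∀ x, T.Adj u x → x = w) (hwv : T.Adj w v) (huv : u ≠ v) :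
    ∃ A B : Finset V, IsBuilt T A w ∧ IsBuilt T B v ∧ IsSplit T A B w v ∧ u ∉ A ∧ u ∉ B ∧
      A ∪ B ∪ {u} = univ := by
  let P : Finset V × Finset V → Prop := fun p =>
    IsBuilt T p.1 w ∧ IsBuilt T p.2 v ∧ IsSplit T p.1 p.2 w v ∧ u ∉ p.1 ∧ u ∉ p.2
  have h0 : P ({w}, {v}) := by
    refine ⟨.single w, .single v, ⟨disjoint_singleton.2 hwv.ne, mem_singleton_self w,
      mem_singleton_self v, hwv, fun x hx y hy _ => ⟨mem_singleton.1 hx, mem_singleton.1 hy⟩⟩,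
      fun h => huw.ne (mem_singleton.1 h), fun h => huv (mem_singleton.1 h)⟩
  obtain ⟨⟨A, B⟩, hP, hmax⟩ := exists_max_image ({p | P p} : Finset (Finset V × Finset V))
    (fun p => #p.1 + #p.2) ⟨_, mem_filter.2 ⟨mem_univ _, h0⟩⟩
  simp only [mem_filter, mem_univ, true_and] at hP hmax
  obtain ⟨hA, hB, hs, huA, huB⟩ := hP
  refine ⟨A, B, hA, hB, hs, huA, huB, ?_⟩
  by_contra hne
  obtain ⟨z, hz⟩ : ∃ z, z ∉ A ∪ B ∪ {u} := by
    by_contra! h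
    exact hne (eq_univ_iff_forall.2 h)
  have hreach := (SimpleGraph.reachable_iff_reflTransGen w z).1 (hT.1.preconnected w z)
  obtain ⟨p, l, hpl, hp, hl⟩ := exists_rel_of_reflTransGen hreach (· ∈ A ∪ B ∪ {u})
    (by simp [hs.left_mem]) hz
  simp only [mem_union, mem_singleton, not_or] at hp hl
  obtain ⟨⟨hlA, hlB⟩, hlu⟩ := hl
  have hpAB : p ∈ A ∪ B := by
    rcases hp with hp | rfl
    · exact mem_union.2 hp
    · exact absurd (hu l hpl ▸ hs.left_mem) hlA
  have hconn : IsConnSet T (A ∪ B) := (hA.join hB hs).isConnSet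
  have honly : ∀ x ∈ A ∪ B, T.Adj x l → x = p := by
    intro x hx hxl
    by_contra hxp
    have hbr := (SimpleGraph.isAcyclic_iff_forall_adj_isBridge.1 hT.2) hpl
    refine (SimpleGraph.isBridge_iff.1 hbr) ?_
    have h1 : (T.deleteEdges {s(p, l)}).Reachable p x := by
      rw [SimpleGraph.reachable_iff_reflTransGen]
      refine ReflTransGen.mono (fun c d hcd => ?_) _ _ (hconn.2 p hpAB x hx)
      have hc : c ≠ l := fun h => by
        have := hcd.2.1
        simp_all
      have hd : d ≠ l := fun h => by
        have := hcd.2.2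
        simp_all
      rw [SimpleGraph.deleteEdges_adj]
      refine ⟨hcd.1, ?_⟩
      simp [hc, hd]
    refine h1.trans (SimpleGraph.Adj.reachable ?_)
    rw [SimpleGraph.deleteEdges_adj]
    refine ⟨hxl, ?_⟩
    simp [hxp, hpl.ne']
  have hd := Finset.disjoint_left.1 hs.disjoint
  rcases mem_union.1 hpAB with hpA | hpB
  · have := hmax (insert l A, B) ⟨hA.insert hlA hpA hpl fun x hx => honly x (mem_union_left _ hx),
      hB, ⟨disjoint_insert_left.2 ⟨hlB, hs.disjoint⟩, mem_insert_of_mem hs.left_mem,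
        hs.right_mem, hs.adj, fun x hx y hy hxy => ?_⟩, by simp [huA, Ne.symm hlu], huB⟩
    · dsimp only at this
      rw [card_insert_of_notMem hlA] at this
      omega
    · rcases mem_insert.1 hx with rfl | hx
      · obtain rfl := honly y (mem_union_right _ hy) hxy.symm
        exact absurd hy (hd hpA)
      · exact hs.only x hx y hy hxy
  · have := hmax (A, insert l B) ⟨hA, hB.insert hlB hpB hpl
      fun x hx => honly x (mem_union_right _ hx), ⟨disjoint_insert_right.2 ⟨hlA, hs.disjoint⟩,
        hs.left_mem, mem_insert_of_mem hs.right_mem, hs.adj, fun x hx y hy hxy => ?_⟩, huA,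
      by simp [huB, Ne.symm hlu]⟩
    · dsimp only at this
      rw [card_insert_of_notMem hlB] at this
      omega
    · rcases mem_insert.1 hy with rfl | hy
      · obtain rfl := honly x (mem_union_left _ hx) hxy
        exact absurd hpB (hd hx)
      · exact hs.only x hx y hy hxy

/-- A connected subgraph of an acyclic graph is induced. -/
lemma adj_of_mem_verts {G H : SimpleGraph V} (hG : G.IsAcyclic) {K : H.Subgraph}
    (hK : K.coe.Connected) (hKG : ∀ x y, K.Adj x y → G.Adj x y) {x y : V} (hx : x ∈ K.verts)
    (hy : y ∈ K.verts) (hxy : G.Adj x y) : K.Adj x y := by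
  by_contra hn
  refine SimpleGraph.isBridge_iff.1 (SimpleGraph.isAcyclic_iff_forall_adj_isBridge.1 hG hxy) ?_
  let φ : K.coe →g G.deleteEdges {s(x, y)} :=
    { toFun := Subtype.val
      map_rel' := fun {a b} hab => by
        have hab : K.Adj a b := hab
        rw [SimpleGraph.deleteEdges_adj]
        refine ⟨hKG _ _ hab, fun h => hn ?_⟩
        rcases Sym2.eq_iff.1 (Set.mem_singleton_iff.1 h) with ⟨h1, h2⟩ | ⟨h1, h2⟩
        · rwa [← h1, ← h2]
        · rw [← h1, ← h2]
          exact hab.symm }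
  exact (hK.preconnected ⟨x, hx⟩ ⟨y, hy⟩).map φ

lemma bijOn_verts [Fintype V] {G H : SimpleGraph V} (hGH : G ≤ H) (hG : G.IsAcyclic) :
    Set.BijOn (fun K : H.Subgraph => K.verts.toFinset)
      {K | K ∈ subtrees H ∧ ∀ x y, K.Adj x y → G.Adj x y} {S | IsConnSet G S} := by
  refine ⟨?_, ?_, ?_⟩
  · rintro K ⟨hK, hKG⟩
    have hK : K.coe.IsTree := hK
    obtain ⟨z⟩ := hK.1.nonempty
    refine ⟨⟨z, Set.mem_toFinset.2 z.2⟩, fun x hx y hy => ?_⟩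
    rw [Set.mem_toFinset] at hx hy
    have h := (SimpleGraph.reachable_iff_reflTransGen _ _).1
      (hK.1.preconnected ⟨x, hx⟩ ⟨y, hy⟩)
    refine ReflTransGen.lift Subtype.val (fun a b hab => ?_) _ _ h
    exact ⟨hKG _ _ hab, Set.mem_toFinset.2 a.2, Set.mem_toFinset.2 b.2⟩
  · rintro K ⟨hK, hKG⟩ K' ⟨hK', hKG'⟩ h
    have hK : K.coe.IsTree := hK
    have hK' : K'.coe.IsTree := hK'
    have hv : K.verts = K'.verts := Set.toFinset_inj.1 h
    refine SimpleGraph.Subgraph.ext hv ?_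
    funext x y
    refine propext ⟨fun hxy => ?_, fun hxy => ?_⟩
    · exact adj_of_mem_verts hG hK'.1 hKG' (hv ▸ hxy.fst_mem) (hv ▸ hxy.snd_mem) (hKG _ _ hxy)
    · exact adj_of_mem_verts hG hK.1 hKG (hv ▸ hxy.fst_mem) (hv ▸ hxy.snd_mem) (hKG' _ _ hxy)
  · intro S hS
    let K : H.Subgraph :=
      { verts := ↑S
        Adj := fun a b => G.Adj a b ∧ a ∈ S ∧ b ∈ S
        adj_sub := fun h => hGH h.1
        edge_vert := fun h => h.2.1
        symm := ⟨fun a b h => ⟨h.1.symm, h.2.2, h.2.1⟩⟩ }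
    refine ⟨K, ⟨⟨?_, ?_⟩, fun x y h => h.1⟩, by simp [K]⟩
    · obtain ⟨z, hz⟩ := hS.1
      have : Nonempty K.verts := ⟨⟨z, hz⟩⟩
      refine ⟨fun x y => ?_⟩
      obtain ⟨x, hx⟩ := x
      obtain ⟨y, hy⟩ := y
      have h := hS.2 x hx y hy
      induction h with
      | refl => exact SimpleGraph.Reachable.refl _
      | @tail b c _ hbc ih =>
        refine (ih hbc.2.1).trans (SimpleGraph.Adj.reachable ?_)
        exact hbc
    · let φ : K.coe →g G :=
        { toFun := Subtype.val
          map_rel' := fun {a b} hab => hab.1 }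
      exact hG.comap φ Subtype.val_injective

lemma finsum_mem_subtrees [Fintype V] {G H : SimpleGraph V} (hGH : G ≤ H) (hG : G.IsAcyclic)
    (p : Finset V → Prop) [DecidablePred p] (f : Finset V → ℝ) :
    ∑ᶠ K ∈ {K : H.Subgraph | (K ∈ subtrees H ∧ ∀ x y, K.Adj x y → G.Adj x y) ∧
      p K.verts.toFinset}, f K.verts.toFinset = ∑ S with IsConnSet G S ∧ p S, f S := by
  have hb := bijOn_verts hGH hG
  rw [finsum_mem_eq_of_bijOn (g := f) (fun K : H.Subgraph => K.verts.toFinset)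
    (t := {S | IsConnSet G S ∧ p S}) ⟨?_, ?_, ?_⟩ fun _ _ => rfl]
  · rw [← finsum_mem_coe_finset]
    congr! 3
    simp
  · exact fun K hK => ⟨hb.mapsTo hK.1, hK.2⟩
  · exact hb.injOn.mono fun K hK => hK.1
  · rintro S ⟨hS, hp⟩
    obtain ⟨K, hK, rfl⟩ := hb.surjOn hS
    exact ⟨K, ⟨hK, hp⟩, rfl⟩

lemma mu_eq [Fintype V] (G : SimpleGraph V) :
    mu G = (∑ᶠ K ∈ subtrees G, (#K.verts.toFinset : ℝ)) / ∑ᶠ K ∈ subtrees G, (1 : ℝ) := by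
  rw [mu, numSubtrees]
  congr 1
  · refine finsum_mem_congr rfl fun K _ => ?_
    rw [Set.ncard_eq_toFinset_card']
  · rw [finsum_mem_eq_finite_toFinset_sum _ (Set.toFinite _), Set.ncard_eq_toFinset_card]
    simp

lemma sum_isConnSet [Fintype V] (G : SimpleGraph V) (w : V) (f : Finset V → ℝ) :
    ∑ S with IsConnSet G S ∧ True, f S =
      ∑ S ∈ rooted G univ w, f S + ∑ S ∈ unrooted G univ w, f S := by
  rw [← sum_filter_add_sum_filter_not _ (fun S => w ∈ S), filter_filter, filter_filter]
  congr 2 <;> ext S <;> simp [mem_rooted, mem_unrooted]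

lemma finsum_mem_subtrees_isAcyclic [Fintype V] {T : SimpleGraph V} (hT : T.IsAcyclic) (w : V)
    (f : Finset V → ℝ) : ∑ᶠ K ∈ subtrees T, f K.verts.toFinset =
      ∑ S ∈ rooted T univ w, f S + ∑ S ∈ unrooted T univ w, f S := by
  rw [← sum_isConnSet, ← finsum_mem_subtrees le_rfl hT (fun _ => True)]
  refine finsum_mem_congr (Set.ext fun K => ?_) fun _ _ => rfl
  exact ⟨fun h => ⟨⟨h, fun x y hxy => hxy.adj_sub⟩, trivial⟩, fun h => h.1.1⟩

/-- The graph obtained from `T` by replacing the edge `xy` with the edge `uv`. -/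
def exchange (T : SimpleGraph V) (x y u v : V) : SimpleGraph V :=
  T.deleteEdges {s(x, y)} ⊔ SimpleGraph.edge u v

lemma exchange_adj {T : SimpleGraph V} {x y u v a b : V} :
    (exchange T x y u v).Adj a b ↔
      (T.Adj a b ∧ s(a, b) ≠ s(x, y)) ∨ (s(a, b) = s(u, v) ∧ a ≠ b) := by
  rw [exchange, SimpleGraph.sup_adj, SimpleGraph.deleteEdges_adj, SimpleGraph.edge_adj,
    Set.mem_singleton_iff, Sym2.eq_iff (x := a) (y := b) (z := u)]

lemma exchange_le (T : SimpleGraph V) (x y u v : V) : exchange T x y u v ≤ addEdge T u v :=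
  sup_le_sup_right (SimpleGraph.deleteEdges_le _) _

lemma addEdge_adj {T : SimpleGraph V} {u v a b : V} :
    (addEdge T u v).Adj a b ↔ T.Adj a b ∨ (s(a, b) = s(u, v) ∧ a ≠ b) := by
  simp [addEdge]

lemma isAcyclic_exchange {T : SimpleGraph V} (hT : T.IsAcyclic) {u v w : V} (huw : T.Adj u w)
    (hwv : T.Adj w v) (huv : u ≠ v) : (exchange T u w u v).IsAcyclic := by
  refine (hT.anti (SimpleGraph.deleteEdges_le _)).sup_edge_of_not_reachable fun h => ?_
  refine SimpleGraph.isBridge_iff.1 (SimpleGraph.isAcyclic_iff_forall_adj_isBridge.1 hT huw) ?_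
  refine h.trans (SimpleGraph.Adj.reachable ?_)
  rw [SimpleGraph.deleteEdges_adj]
  exact ⟨hwv.symm, by simp [huv.symm, hwv.ne']⟩

lemma exchange_swap (T : SimpleGraph V) (x y u v : V) :
    exchange T x y u v = exchange T x y v u := by
  rw [exchange, exchange, SimpleGraph.edge_comm]

/-- The subtrees created by closing the path `u`, `w`, `v` of a forest to a triangle, sorted by
whether they use `vw`. -/
lemma finsum_mem_subtrees_addEdge [Fintype V] {T : SimpleGraph V} (hT : T.IsAcyclic) {u v w : V}
    (huw : T.Adj u w) (hwv : T.Adj w v) (huv : u ≠ v) (hn : ¬ T.Adj u v) (f : Finset V → ℝ) :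
    ∑ᶠ K ∈ subtrees (addEdge T u v), f K.verts.toFinset =
      ∑ S with IsConnSet T S ∧ True, f S +
      (∑ S with IsConnSet (exchange T v w u v) S ∧ (u ∈ S ∧ v ∈ S), f S +
      ∑ S with IsConnSet (exchange T u w u v) S ∧ (u ∈ S ∧ v ∈ S ∧ w ∈ S), f S) := by
  have hT1 : (exchange T v w u v).IsAcyclic :=
    exchange_swap T v w u v ▸ isAcyclic_exchange hT hwv.symm huw.symm huv.symm
  have hT2 : (exchange T u w u v).IsAcyclic := isAcyclic_exchange hT huw hwv huv
  have hle0 : T ≤ addEdge T u v := le_sup_left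
  have hle1 := exchange_le T v w u v
  have hle2 := exchange_le T u w u v
  rw [← finsum_mem_subtrees hle0 hT (fun _ => True),
    ← finsum_mem_subtrees hle1 hT1 (fun S => u ∈ S ∧ v ∈ S),
    ← finsum_mem_subtrees hle2 hT2 (fun S => u ∈ S ∧ v ∈ S ∧ w ∈ S),
    ← finsum_mem_union _ (Set.toFinite _) (Set.toFinite _),
    ← finsum_mem_union _ (Set.toFinite _) (Set.toFinite _)]
  · refine finsum_mem_congr (Set.ext fun K => ?_) fun _ _ => rfl
    constructor
    · intro hK
      have hK' : K.coe.IsTree := hK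
      by_cases h1 : K.Adj u v
      · right
        by_cases h2 : K.Adj v w
        · right
          refine ⟨⟨hK, fun x y hxy => ?_⟩, by simp [h1.fst_mem, h1.snd_mem, h2.snd_mem]⟩
          have h3 : ¬ K.Adj u w := by
            intro h3
            have h := SimpleGraph.isAcyclic_iff_forall_adj_isBridge.1 hK'.2
              (v := ⟨u, h1.fst_mem⟩) (w := ⟨v, h1.snd_mem⟩) h1
            refine SimpleGraph.isBridge_iff.1 h ?_
            have e1 : (K.coe.deleteEdges {s(⟨u, h1.fst_mem⟩, ⟨v, h1.snd_mem⟩)}).Adj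
                ⟨u, h1.fst_mem⟩ ⟨w, h3.snd_mem⟩ := by
              rw [SimpleGraph.deleteEdges_adj]
              exact ⟨h3, by simp [huv, hwv.ne]⟩
            have e2 : (K.coe.deleteEdges {s(⟨u, h1.fst_mem⟩, ⟨v, h1.snd_mem⟩)}).Adj
                ⟨w, h3.snd_mem⟩ ⟨v, h1.snd_mem⟩ := by
              rw [SimpleGraph.deleteEdges_adj]
              exact ⟨h2.symm, by simp [huw.ne', hwv.ne]⟩
            exact e1.reachable.trans e2.reachable
          rw [exchange_adj]
          rcases addEdge_adj.1 hxy.adj_sub with h | h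
          · refine .inl ⟨h, fun he => h3 ?_⟩
            rwa [← SimpleGraph.Subgraph.mem_edgeSet, ← he]
          · exact .inr h
        · left
          refine ⟨⟨hK, fun x y hxy => ?_⟩, by simp [h1.fst_mem, h1.snd_mem]⟩
          rw [exchange_adj]
          rcases addEdge_adj.1 hxy.adj_sub with h | h
          · refine .inl ⟨h, fun he => h2 ?_⟩
            rwa [← SimpleGraph.Subgraph.mem_edgeSet, ← he]
          · exact .inr h
      · left
        refine ⟨⟨hK, fun x y hxy => ?_⟩, trivial⟩
        rcases addEdge_adj.1 hxy.adj_sub with h | h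
        · exact h
        · refine absurd ?_ h1
          rwa [← SimpleGraph.Subgraph.mem_edgeSet, ← h.1]
    · rintro (h | h | h) <;> exact h.1.1
  · refine Set.disjoint_left.2 fun K h1 h2 => ?_
    have hK : K.coe.IsTree := h1.1.1
    have huvK : K.Adj u v := by
      rcases h2 with h2 | h2
      · have hp := h2.2
        simp only [Set.mem_toFinset] at hp
        exact adj_of_mem_verts hT1 hK.1 h2.1.2 hp.1 hp.2 (exchange_adj.2 (.inr ⟨rfl, huv⟩))
      · have hp := h2.2
        simp only [Set.mem_toFinset] at hp
        exact adj_of_mem_verts hT2 hK.1 h2.1.2 hp.1 hp.2.1 (exchange_adj.2 (.inr ⟨rfl, huv⟩))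
    exact hn (h1.1.2 _ _ huvK)
  · refine Set.disjoint_left.2 fun K h1 h2 => ?_
    have hK : K.coe.IsTree := h1.1.1
    have hp := h2.2
    simp only [Set.mem_toFinset] at hp
    have hvw := adj_of_mem_verts hT2 hK.1 h2.1.2 hp.2.1 hp.2.2
      (exchange_adj.2 (.inl ⟨hwv.symm, by simp [huv.symm, hwv.ne']⟩))
    have := exchange_adj.1 (h1.1.2 _ _ hvw)
    simp [huv.symm, hwv.ne', huw.ne'] at this

section Triangle

variable {T : SimpleGraph V} {A B : Finset V} {u v w : V}

lemma rooted_exchange {C : Finset V} {x y z : V} (hu : u ∉ C) (hxy : x ∉ C ∨ y ∉ C) :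
    rooted (exchange T x y u v) C z = rooted T C z := by
  refine rooted_congr fun a ha b hb => ?_
  rw [exchange_adj]
  have h1 : s(a, b) ≠ s(u, v) := by
    rintro h
    rcases Sym2.eq_iff.1 h with ⟨rfl, rfl⟩ | ⟨rfl, rfl⟩ <;> exact hu (by assumption)
  have h2 : s(a, b) ≠ s(x, y) := by
    rintro h
    rcases Sym2.eq_iff.1 h with ⟨rfl, rfl⟩ | ⟨rfl, rfl⟩ <;> tauto
  tauto

lemma isSplit_exchange_left (hs : IsSplit T A B w v) (huw : T.Adj u w)
    (hu : ∀ x, T.Adj u x → x = w) (huv : u ≠ v) (huA : u ∉ A) :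
    IsSplit (exchange T v w u v) {u} A u w := by
  refine ⟨disjoint_singleton_left.2 huA, mem_singleton_self u, hs.left_mem,
    exchange_adj.2 (.inl ⟨huw, by simp [huv, huw.ne]⟩), fun x hx y hy hxy => ?_⟩
  obtain rfl := mem_singleton.1 hx
  rcases exchange_adj.1 hxy with h | h
  · exact ⟨rfl, hu y h.1⟩
  · rcases Sym2.eq_iff.1 h.1 with ⟨-, rfl⟩ | ⟨rfl, -⟩
    · exact absurd hs.right_mem (Finset.disjoint_left.1 hs.disjoint hy)
    · exact absurd rfl huv

lemma isSplit_exchange_left_union (hs : IsSplit T A B w v)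
    (hu : ∀ x, T.Adj u x → x = w) (huv : u ≠ v) (huA : u ∉ A) (huB : u ∉ B) :
    IsSplit (exchange T v w u v) ({u} ∪ A) B u v := by
  have hd := Finset.disjoint_left.1 hs.disjoint
  refine ⟨disjoint_union_left.2 ⟨disjoint_singleton_left.2 huB, hs.disjoint⟩,
    mem_union_left _ (mem_singleton_self u), hs.right_mem, exchange_adj.2 (.inr ⟨rfl, huv⟩),
    fun x hx y hy hxy => ?_⟩
  rcases exchange_adj.1 hxy with ⟨h, h'⟩ | ⟨h, -⟩
  · rcases mem_union.1 hx with hx | hx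
    · obtain rfl := mem_singleton.1 hx
      exact absurd hy (hd (hu y h ▸ hs.left_mem))
    · obtain ⟨rfl, rfl⟩ := hs.only x hx y hy h
      exact absurd Sym2.eq_swap h'
  · rcases Sym2.eq_iff.1 h with h | ⟨-, rfl⟩
    · exact h
    · exact absurd hy huB

lemma isSplit_exchange_right (hs : IsSplit T A B w v) (huA : u ∉ A) (huB : u ∉ B) :
    IsSplit (exchange T u w u v) B A v w := by
  have hs' := hs.symm
  refine ⟨hs'.disjoint, hs.right_mem, hs.left_mem, exchange_adj.2 (.inl ⟨hs.adj.symm, ?_⟩),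
    fun x hx y hy hxy => ?_⟩
  · intro h
    rcases Sym2.eq_iff.1 h with ⟨rfl, -⟩ | ⟨rfl, rfl⟩
    · exact huB hs.right_mem
    · exact huA hs.left_mem
  · rcases exchange_adj.1 hxy with h | h
    · exact hs'.only x hx y hy h.1
    · rcases Sym2.eq_iff.1 h.1 with ⟨rfl, -⟩ | ⟨-, rfl⟩
      · exact absurd hx huB
      · exact absurd hy huA

lemma isSplit_exchange_right_union (hs : IsSplit T A B w v) (hu : ∀ x, T.Adj u x → x = w)
    (huv : u ≠ v) (huA : u ∉ A) (huB : u ∉ B) :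
    IsSplit (exchange T u w u v) (B ∪ A) {u} v u := by
  refine ⟨disjoint_singleton_right.2 (by simp [huA, huB]), mem_union_left _ hs.right_mem,
    mem_singleton_self u, exchange_adj.2 (.inr ⟨Sym2.eq_swap, huv.symm⟩), fun x hx y hy hxy => ?_⟩
  obtain rfl := mem_singleton.1 hy
  rcases exchange_adj.1 hxy with ⟨h, h'⟩ | ⟨h, hne⟩
  · obtain rfl := hu x h.symm
    exact absurd Sym2.eq_swap h'
  · rcases Sym2.eq_iff.1 h with ⟨h1, h2⟩ | h
    · exact absurd h2 huv
    · exact h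

lemma sum_exchange_left [Fintype V] (hs : IsSplit T A B w v) (hu : ∀ x, T.Adj u x → x = w)
    (huv : u ≠ v) (huA : u ∉ A) (huB : u ∉ B) (hU : A ∪ B ∪ {u} = univ) (f : Finset V → ℝ) :
    ∑ S with IsConnSet (exchange T v w u v) S ∧ (u ∈ S ∧ v ∈ S), f S =
      ∑ S ∈ rooted (exchange T v w u v) ({u} ∪ A) u, ∑ S' ∈ rooted T B v, f (S ∪ S') := by
  have hwB : w ∉ B := Finset.disjoint_left.1 hs.disjoint hs.left_mem
  rw [← rooted_exchange (x := v) (y := w) (v := v) huB (.inr hwB),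
    ← (isSplit_exchange_left_union hs hu huv huA huB).sum_both]
  refine sum_congr (Finset.ext fun S => ?_) fun _ _ => rfl
  rw [mem_filter, mem_filter, mem_rooted,
    show {u} ∪ A ∪ B = univ by rw [← hU, union_assoc, union_comm]]
  simp [and_assoc]

lemma sum_exchange_right [Fintype V] (hs : IsSplit T A B w v) (hu : ∀ x, T.Adj u x → x = w)
    (huv : u ≠ v) (huw : u ≠ w) (huA : u ∉ A) (huB : u ∉ B) (hU : A ∪ B ∪ {u} = univ)
    (f : Finset V → ℝ) :
    ∑ S with IsConnSet (exchange T u w u v) S ∧ (u ∈ S ∧ v ∈ S ∧ w ∈ S), f S =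
      ∑ S ∈ rooted T B v, ∑ S' ∈ rooted T A w, f (S ∪ S' ∪ {u}) := by
  rw [← rooted_exchange (x := u) (y := w) (v := v) huB (.inl huB),
    ← rooted_exchange (x := u) (y := w) (v := v) huA (.inl huA),
    ← (isSplit_exchange_right hs huA huB).sum_both (fun S => f (S ∪ {u}))]
  have key := (isSplit_exchange_right_union hs hu huv huA huB).sum_both
    (fun S => if w ∈ S then f S else 0)
  simp only [rooted_singleton, sum_singleton, mem_union, mem_singleton, huw.symm, or_false] at key
  rw [← sum_filter, ← sum_filter, filter_filter] at key
  rw [← key]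
  refine sum_congr (Finset.ext fun S => ?_) fun _ _ => rfl
  rw [mem_filter, mem_filter, mem_rooted,
    show B ∪ A ∪ {u} = univ by rw [← hU, union_comm B A]]
  simp only [mem_univ, subset_univ, true_and]
  tauto

end Triangle

lemma mean_lt_of_bounds {a b r q : ℝ} (ha : 1 ≤ a) (hb : 1 ≤ b) (hr : r ≤ a ^ 2) (hq : b ≤ q) :
    (2 * (r * (1 + b) + a * q) + a * (1 + b)) * (b * (1 + 2 * a)) <
      (2 * a * (1 + b)) * (q * (1 + 2 * a) + b * (1 + 2 * a) + 2 * b * r) := by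
  have h1 : r * (b * (1 + b)) ≤ a ^ 2 * (b * (1 + b)) := by gcongr
  have h2 : 0 < a * b * (1 + b) := by positivity
  have h3 : 0 < a * q * (1 + 2 * a) := by
    have : 0 < q := by linarith
    positivity
  linarith

lemma exists_pendant_path [Fintype V] {T : SimpleGraph V} (hT : T.IsTree)
    (hn : 3 ≤ Fintype.card V) :
    ∃ u w v, T.Adj u w ∧ (∀ x, T.Adj u x → x = w) ∧ T.Adj w v ∧ u ≠ v := by
  have : Nontrivial V := Fintype.one_lt_card_iff_nontrivial.1 (by omega)
  obtain ⟨u, hu⟩ := hT.exists_vert_degree_one_of_nontrivial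
  obtain ⟨w, huw, hu⟩ := SimpleGraph.degree_eq_one_iff_existsUnique_adj.1 hu
  obtain ⟨z, hz⟩ : ∃ z, z ∉ ({u, w} : Finset V) := by
    by_contra! h
    have h1 : #({u, w} : Finset V) = Fintype.card V := by rw [eq_univ_iff_forall.2 h, card_univ]
    have h2 : #({u, w} : Finset V) ≤ 2 := card_le_two
    omega
  obtain ⟨c, d, hcd, hc, hd⟩ := exists_rel_of_reflTransGen
    ((SimpleGraph.reachable_iff_reflTransGen u z).1 (hT.1.preconnected u z))
    (· ∈ ({u, w} : Finset V)) (mem_insert_self u _) hz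
  simp only [mem_insert, mem_singleton, not_or] at hc hd
  rcases hc with rfl | rfl
  · exact absurd (hu d hcd) hd.2
  · exact ⟨u, c, d, huw, hu, hcd, Ne.symm hd.1⟩

/-- Joining a pendant vertex `u` of a tree to a vertex `v` at distance two increases the mean
subtree order. -/
lemma mu_lt_mu_addEdge [Fintype V] {T : SimpleGraph V} (hT : T.IsTree) {u v w : V}
    (huw : T.Adj u w) (hu : ∀ x, T.Adj u x → x = w) (hwv : T.Adj w v) (huv : u ≠ v) :
    mu T < mu (addEdge T u v) := by
  obtain ⟨A, B, hA, hB, hs, huA, huB, hU⟩ := exists_isBuilt_isSplit hT huw hu hwv huv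
  have hnuv : ¬ T.Adj u v := fun h => hwv.ne (hu v h).symm
  have hsu : IsSplit T (A ∪ B) {u} w u := by
    refine ⟨disjoint_singleton_right.2 (by simp [huA, huB]), mem_union_left _ hs.left_mem,
      mem_singleton_self u, huw.symm, fun x _ y hy hxy => ?_⟩
    obtain rfl := mem_singleton.1 hy
    exact ⟨hu x hxy.symm, rfl⟩
  have hwA : w ∈ A := hs.left_mem
  have hv : v ∈ B := hs.right_mem
  have hvA : v ∉ A := fun h => Finset.disjoint_left.1 hs.disjoint h hv
  have hl := isSplit_exchange_left hs huw hu huv huA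
  have hlu := isSplit_exchange_left_union hs hu huv huA huB
  have hwB : w ∉ B := Finset.disjoint_left.1 hs.disjoint hwA
  have hGA : rooted (exchange T v w u v) A w = rooted T A w :=
    rooted_exchange huA (.inl hvA)
  have hGB : rooted (exchange T v w u v) B v = rooted T B v :=
    rooted_exchange huB (.inr hwB)
  have hJ := (((hA.join hB hs).join (.single u) hsu)).tot_unrooted_mul_le
  have hNw := hsu.cnt_rooted
  have hRw := hsu.tot_rooted
  rw [cnt_rooted_singleton, hs.cnt_rooted] at hNw
  rw [cnt_rooted_singleton, tot_rooted_singleton, hs.cnt_rooted, hs.tot_rooted] at hRw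
  rw [hU] at hJ hNw hRw
  have ha := one_le_cnt_rooted T hwA
  have hb := one_le_cnt_rooted T hv
  have hlt := mean_lt_of_bounds ha hb hA.tot_rooted_le (cnt_rooted_le_tot_rooted T B v)
  have hX := cnt_nonneg (unrooted T univ w)
  have hcl := hl.cnt_rooted
  have htl := hl.tot_rooted
  rw [cnt_rooted_singleton, hGA] at hcl
  rw [cnt_rooted_singleton, tot_rooted_singleton, hGA] at htl
  have hcard : ∑ S ∈ rooted T B v, ∑ S' ∈ rooted T A w, (#(S ∪ S' ∪ {u}) : ℝ) =
      tot (rooted T B v) * cnt (rooted T A w) + cnt (rooted T B v) * tot (rooted T A w) +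
        cnt (rooted T B v) * cnt (rooted T A w) := by
    rw [← hs.symm.sum_sum_card, ← sum_sum_one, ← sum_add_distrib]
    refine sum_congr rfl fun S hS => ?_
    rw [← sum_add_distrib]
    refine sum_congr rfl fun S' hS' => ?_
    rw [card_union_of_disjoint (disjoint_singleton_right.2 ?_), card_singleton]
    · push_cast
      rfl
    · rw [mem_union, not_or]
      exact ⟨fun h => huB ((mem_rooted.1 hS).1 h), fun h => huA ((mem_rooted.1 hS').1 h)⟩
  have hsplit := hlu.sum_sum_card (w' := u) (b' := v)
  rw [hGB] at hsplit
  have hTsum := finsum_mem_subtrees_isAcyclic hT.2 w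
  have hHsum := finsum_mem_subtrees_addEdge hT.2 huw hwv huv hnuv
  simp only [sum_isConnSet T w, sum_exchange_left hs hu huv huA huB hU,
    sum_exchange_right hs hu huv huw.ne huA huB hU] at hHsum
  rw [mu_eq, mu_eq, hTsum (fun S => (#S : ℝ)), hTsum (fun _ => 1), hHsum (fun S => (#S : ℝ)),
    hHsum (fun _ => 1), sum_sum_one, sum_sum_one, hsplit, hcard, hcl, htl]
  change (tot _ + tot _) / (cnt _ + cnt _) <
    (tot _ + tot _ + _) / (cnt (rooted T univ w) + cnt (unrooted T univ w) + _)
  set a := cnt (rooted T A w)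
  set b := cnt (rooted T B v)
  set r := tot (rooted T A w)
  set q := tot (rooted T B v)
  set N := cnt (rooted T univ w)
  set R := tot (rooted T univ w)
  set X := cnt (unrooted T univ w)
  set S := tot (unrooted T univ w)
  have hN : N = 2 * a * (1 + b) := by rw [hNw]; ring
  have hR : R = 2 * (r * (1 + b) + a * q) + a * (1 + b) := by rw [hRw]; ring
  rw [← hN, ← hR] at hlt
  have hN0 : 0 < N := by rw [hN]; positivity
  have hM0 : 0 < b * (1 + 2 * a) := by positivity
  rw [show (1 + 1 * a) * b + b * a = b * (1 + 2 * a) by ring,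
    show (1 + (1 * a + 1 * r)) * b + (1 + 1 * a) * q + (q * a + b * r + b * a) =
      q * (1 + 2 * a) + b * (1 + 2 * a) + 2 * b * r by ring]
  set M := b * (1 + 2 * a)
  set E := q * (1 + 2 * a) + M + 2 * b * r
  have h1 : (R + S) / (N + X) ≤ R / N := by
    rw [div_le_div_iff₀ (by linarith) hN0]
    linarith
  have h2 : R / N < E / M := by
    rw [div_lt_div_iff₀ hN0 hM0]
    linarith
  have h3 := h1.trans_lt h2
  rw [div_lt_div_iff₀ (by linarith) hM0] at h3
  rw [div_lt_div_iff₀ (by linarith) (by linarith)]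
  linarith

end Helpers

/-- For every tree `T` of order `n ≥ 3`, there are two distinct nonadjacent vertices
whose joining increases the mean subtree order. -/
theorem tree_exists_edge_addition_increasing_mu {V : Type*} [Fintype V]
    (T : SimpleGraph V) (hT : T.IsTree) (hn : 3 ≤ Fintype.card V) :
    ∃ u v : V, u ≠ v ∧ ¬ T.Adj u v ∧ mu (addEdge T u v) > mu T := by
  obtain ⟨u, w, v, huw, hu, hwv, huv⟩ := exists_pendant_path hT hn
  have hnuv : ¬ T.Adj u v := fun h => hwv.ne (hu v h).symm
  exact ⟨u, v, huv, hnuv, mu_lt_mu_addEdge hT huw hu hwv huv⟩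

end SubtreePaper
end
end

section
/- If G is a finite simple graph with at least one edge, then there exists an edge e of G such that μ(G,e) > μ(G) > μ(G − e), where G − e denotes the graph obtained from G by deleting the edge e. -/
open Filter Topology

noncomputable section

namespace SubtreePaper

/-- The sum of a nonconstant function, squared, is strictly less than the number of terms times
the sum of its squares. -/
theorem sq_sum_lt_card_mul_sum_sq {ι : Type*} (T : Finset ι) (t : ι → ℝ) {i j : ι}
    (hi : i ∈ T) (hj : j ∈ T) (hij : t i ≠ t j) :
    (∑ k ∈ T, t k) ^ 2 < T.card * ∑ k ∈ T, t k ^ 2 := by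
  by_contra! hle
  set S := ∑ k ∈ T, t k with hS
  have hcard : (0 : ℝ) < T.card := by exact_mod_cast Finset.card_pos.mpr ⟨i, hi⟩
  have hsum : ∑ k ∈ T, (T.card * t k - S) ^ 2 = T.card * (T.card * ∑ k ∈ T, t k ^ 2 - S ^ 2) := by
    have hexp : ∀ k ∈ T, (T.card * t k - S) ^ 2 =
        (T.card : ℝ) ^ 2 * t k ^ 2 - 2 * T.card * S * t k + S ^ 2 := fun k _ => by ring
    rw [Finset.sum_congr rfl hexp, Finset.sum_add_distrib, Finset.sum_sub_distrib,
      ← Finset.mul_sum, ← Finset.mul_sum, Finset.sum_const, nsmul_eq_mul, ← hS]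
    ring
  have hzero : ∑ k ∈ T, (T.card * t k - S) ^ 2 = 0 := by
    refine le_antisymm ?_ (Finset.sum_nonneg fun k _ => sq_nonneg _)
    rw [hsum]
    exact mul_nonpos_of_nonneg_of_nonpos hcard.le (by linarith)
  rw [Finset.sum_eq_zero_iff_of_nonneg fun k _ => sq_nonneg _] at hzero
  have h₁ : T.card * t i - S = 0 := pow_eq_zero_iff two_ne_zero |>.mp (hzero i hi)
  have h₂ : T.card * t j - S = 0 := pow_eq_zero_iff two_ne_zero |>.mp (hzero j hj)
  exact hij (mul_left_cancel₀ hcard.ne' (by linarith))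

open Classical in
/-- If every `k ∈ T` is incident with `t k - 1` elements of `E` and `t` is nonconstant on `T`, then
some `e ∈ E` is such that the elements incident with `e` have a larger mean than `T`. -/
theorem exists_sum_mul_card_lt {ι κ : Type*} (T : Finset ι) (E : Finset κ) (R : ι → κ → Prop)
    (t : ι → ℝ) (hR : ∀ k ∈ T, ((E.filter (R k)).card : ℝ) = t k - 1) {i j : ι}
    (hi : i ∈ T) (hj : j ∈ T) (hij : t i ≠ t j) :
    ∃ e ∈ E, (∑ k ∈ T, t k) * (T.filter (R · e)).card <
      T.card * ∑ k ∈ T.filter (R · e), t k := by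
  by_contra! hle
  have hlt := sq_sum_lt_card_mul_sum_sq T t hi hj hij
  have key : ∀ f : ι → ℝ, ∑ e ∈ E, ∑ k ∈ T.filter (R · e), f k = ∑ k ∈ T, f k * (t k - 1) := by
    intro f
    simp only [Finset.sum_filter]
    rw [Finset.sum_comm]
    refine Finset.sum_congr rfl fun k hk => ?_
    rw [← Finset.sum_filter, Finset.sum_const, nsmul_eq_mul, hR k hk, mul_comm]
  have hcard : ∑ e ∈ E, ((T.filter (R · e)).card : ℝ) = ∑ k ∈ T, (t k - 1) := by
    simpa using key 1
  have hsum := Finset.sum_le_sum hle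
  rw [← Finset.mul_sum, ← Finset.mul_sum, key, hcard] at hsum
  have hsq : ∑ k ∈ T, t k * (t k - 1) = ∑ k ∈ T, t k ^ 2 - ∑ k ∈ T, t k := by
    rw [← Finset.sum_sub_distrib]
    exact Finset.sum_congr rfl fun k _ => by ring
  rw [hsq, Finset.sum_sub_distrib, Finset.sum_const, nsmul_eq_mul] at hsum
  nlinarith

/-- The number of edges of a subtree is one less than its order. -/
theorem ncard_edgeSet_add_one {V : Type*} [Fintype V] {G : SimpleGraph V} {H : G.Subgraph}
    (hH : H ∈ subtrees G) : H.edgeSet.ncard + 1 = H.verts.ncard := by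
  classical
  have htree : H.coe.IsTree := hH
  rw [← H.image_coe_edgeSet_coe, Set.ncard_image_of_injective _
    (Sym2.map.injective Subtype.val_injective), Set.ncard_eq_toFinset_card',
    ← Nat.card_coe_set_eq, Nat.card_eq_fintype_card]
  exact htree.card_edgeFinset

/-- A subgraph of `G.deleteEdges s` regarded as a subgraph of `G`. -/
def ofDeleteEdges {V : Type*} (G : SimpleGraph V) (s : Set (Sym2 V))
    (H : (G.deleteEdges s).Subgraph) : G.Subgraph where
  verts := H.verts
  Adj := H.Adj
  adj_sub h := G.deleteEdges_le s (H.adj_sub h)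
  edge_vert := H.edge_vert
  symm := H.symm

/-- The subtrees of `G - e` are the subtrees of `G` that do not contain `e`. -/
theorem bijOn_ofDeleteEdges {V : Type*} (G : SimpleGraph V) (e : Sym2 V) :
    Set.BijOn (ofDeleteEdges G {e}) (subtrees (G.deleteEdges {e}))
      {H ∈ subtrees G | e ∉ H.edgeSet} := by
  refine ⟨fun H hH => ⟨hH, fun he => ?_⟩, fun H _ H' _ heq => ?_, fun H hH => ?_⟩
  · have he' : e ∈ H.edgeSet := he
    have := H.edgeSet_subset he'
    simp at this
  · exact SimpleGraph.Subgraph.ext (congrArg (·.verts) heq) (congrArg (·.Adj) heq)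
  · refine ⟨⟨H.verts, H.Adj, fun {v w} hvw => ?_, H.edge_vert, H.symm⟩, hH.1, rfl⟩
    refine SimpleGraph.deleteEdges_adj.mpr ⟨H.adj_sub hvw, ?_⟩
    rintro rfl
    exact hH.2 hvw

/-- Every graph with at least one edge has an edge `e` with `μ(G,e) > μ(G) > μ(G - e)`. -/
theorem exists_edge_deletion_decreasing_mu {V : Type*} [Fintype V]
    (G : SimpleGraph V) (h : G.edgeSet.Nonempty) :
    ∃ e ∈ G.edgeSet, muEdge G e > mu G ∧ mu G > mu (G.deleteEdges {e}) := by
  classical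
  obtain ⟨e₀, he₀⟩ := h
  induction e₀ with | h u v =>
  rw [SimpleGraph.mem_edgeSet] at he₀
  set T : Finset G.Subgraph := (Set.toFinite (subtrees G)).toFinset with hT
  have hmem : ∀ H, H ∈ T ↔ H ∈ subtrees G := by simp [hT]
  have hsingle : G.singletonSubgraph u ∈ T :=
    (hmem _).mpr (SimpleGraph.IsTree.coe_singletonSubgraph G u)
  obtain ⟨e, he, hlt⟩ := exists_sum_mul_card_lt T G.edgeFinset (fun H e => e ∈ H.edgeSet)
    (fun H => (H.verts.ncard : ℝ)) (fun H hH => by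
      have hcard := ncard_edgeSet_add_one ((hmem H).mp hH)
      rw [← hcard, Nat.cast_add_one, add_sub_cancel_right, ← Set.ncard_coe_finset]
      congr 2
      ext e
      simpa using fun h => H.edgeSet_subset h)
    hsingle ((hmem _).mpr (SimpleGraph.IsTree.coe_subgraphOfAdj he₀))
    (by simp [Set.ncard_pair he₀.ne])
  refine ⟨e, SimpleGraph.mem_edgeFinset.mp he, ?_⟩
  set A := T.filter (fun H => e ∈ H.edgeSet)
  set B := T.filter (fun H => e ∉ H.edgeSet)
  have hTset : subtrees G = T := by ext; simp [hmem]
  have hA : {H ∈ subtrees G | e ∈ H.edgeSet} = A := by ext; simp [A, hmem]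
  have hB : {H ∈ subtrees G | e ∉ H.edgeSet} = B := by ext; simp [B, hmem]
  have hmu : mu G = (∑ H ∈ T, (H.verts.ncard : ℝ)) / T.card := by
    rw [mu, numSubtrees, hTset, finsum_mem_coe_finset, Set.ncard_coe_finset]
  have hmuA : muEdge G e = (∑ H ∈ A, (H.verts.ncard : ℝ)) / A.card := by
    rw [muEdge, hA, finsum_mem_coe_finset, Set.ncard_coe_finset]
  have hmuB : mu (G.deleteEdges {e}) = (∑ H ∈ B, (H.verts.ncard : ℝ)) / B.card := by
    have hbij := bijOn_ofDeleteEdges G e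
    rw [mu, numSubtrees, hbij.ncard_eq,
      finsum_mem_eq_of_bijOn (f := fun H => (H.verts.ncard : ℝ))
        (g := fun H : G.Subgraph => (H.verts.ncard : ℝ)) _ hbij
        fun _ _ => rfl, hB, finsum_mem_coe_finset, Set.ncard_coe_finset]
  have hsum : ∑ H ∈ A, (H.verts.ncard : ℝ) + ∑ H ∈ B, (H.verts.ncard : ℝ) =
      ∑ H ∈ T, (H.verts.ncard : ℝ) := Finset.sum_filter_add_sum_filter_not ..
  have hcard : (A.card : ℝ) + B.card = T.card := by
    exact_mod_cast Finset.card_filter_add_card_filter_not (s := T) (fun H => e ∈ H.edgeSet)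
  have hTpos : (0 : ℝ) < T.card := by exact_mod_cast Finset.card_pos.mpr ⟨_, hsingle⟩
  have hBpos : (0 : ℝ) < B.card := by
    refine Nat.cast_pos.mpr (Finset.card_pos.mpr ⟨_, Finset.mem_filter.mpr ⟨hsingle, ?_⟩⟩)
    simp
  have hApos : (0 : ℝ) < A.card := by
    refine Nat.cast_pos.mpr (Finset.card_pos.mpr (Finset.nonempty_iff_ne_empty.mpr fun h => ?_))
    simp [h] at hlt
  rw [hmu, hmuA, hmuB]
  refine ⟨(div_lt_div_iff₀ hTpos hApos).mpr (by linarith), (div_lt_div_iff₀ hBpos hTpos).mpr ?_⟩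
  rw [← hsum, ← hcard] at hlt ⊢
  linarith

end SubtreePaper
end
end

section
/- Let n ≥ 3 and let e be a fixed edge of the cycle graph C_n. The local mean subtree order of C_n at e equals (2n+2)/3, i.e., μ(C_n, e) = (2n+2)/3. -/
open Filter Topology

noncomputable section

namespace SubtreePaper

/-- A graph is acyclic if its vertices embed in `ℕ` so that adjacent vertices have consecutive
values. -/
theorem isAcyclic_of_injective_consecutive {V : Type*} {G : SimpleGraph V} (f : V → ℕ)
    (hf : Function.Injective f) (h : ∀ u v, G.Adj u v → f v = f u + 1 ∨ f u = f v + 1) :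
    G.IsAcyclic := by
  have bridge : ∀ u v, G.Adj u v → f v = f u + 1 → G.IsBridge s(u, v) := by
    intro u v _ hv
    rw [SimpleGraph.isBridge_iff]
    rintro ⟨w⟩
    have key : ∀ x y, (G.deleteEdges {s(u, v)}).Walk x y → f x ≤ f u → f y ≤ f u := by
      intro x y w
      induction w with
      | nil => exact id
      | @cons x y z hxy _ ih =>
        intro hx
        apply ih
        rw [SimpleGraph.deleteEdges_adj] at hxy
        rcases h x y hxy.1 with h1 | h1
        · by_contra hy
          have hxu : x = u := hf (by omega)
          have hyv : y = v := hf (by omega)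
          exact hxy.2 (by simp [hxu, hyv])
        · omega
    have := key u v w le_rfl
    omega
  rw [SimpleGraph.isAcyclic_iff_forall_adj_isBridge]
  intro u v huv
  rcases h u v huv with h1 | h1
  · exact bridge u v huv h1
  · rw [Sym2.eq_swap]
    exact bridge v u huv.symm h1

section Arc

variable {k : ℕ}

theorem val_add_one_sub (x s : Fin (k + 3)) :
    (x + 1 = s ∧ (x - s).val = k + 2 ∧ (x + 1 - s).val = 0) ∨
      (x + 1 ≠ s ∧ (x - s).val < k + 2 ∧ (x + 1 - s).val = (x - s).val + 1) := by
  have h : x + 1 - s = (x - s) + 1 := add_sub_right_comm x 1 s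
  have h2 := Fin.val_add_one (x - s)
  rw [← h] at h2
  by_cases hx : x + 1 = s
  · left
    have h0 : (x + 1 - s).val = 0 := by simp [hx]
    refine ⟨hx, ?_, h0⟩
    split_ifs at h2 with hl
    · simp [hl]
    · omega
  · right
    have h0 : (x + 1 - s).val ≠ 0 := by
      rw [Fin.val_ne_zero_iff]
      exact sub_ne_zero.2 hx
    split_ifs at h2 with hl
    · omega
    · refine ⟨hx, ?_, h2⟩
      have := (x - s).isLt
      have h3 : (x - s).val ≠ k + 2 := fun h => hl (Fin.ext (by simpa using h))
      omega

theorem eq_of_val_sub_eq {x y s : Fin (k + 3)} (h : (x - s).val = (y - s).val) : x = y :=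
  sub_left_injective (Fin.ext h)

theorem cycleGraph_adj_add_one (x : Fin (k + 3)) :
    (SimpleGraph.cycleGraph (k + 3)).Adj x (x + 1) := by
  rw [SimpleGraph.cycleGraph_adj]
  right
  simp

theorem cycleGraph_adj_iff_add_one {x y : Fin (k + 3)} :
    (SimpleGraph.cycleGraph (k + 3)).Adj x y ↔ y = x + 1 ∨ x = y + 1 := by
  rw [SimpleGraph.cycleGraph_adj, sub_eq_iff_eq_add', sub_eq_iff_eq_add', or_comm]

theorem ne_add_one_add_one (x : Fin (k + 3)) : x ≠ x + 1 + 1 := by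
  intro h
  have h1 := val_add_one_sub x x
  have h2 := val_add_one_sub (x + 1) x
  have h0 : (x - x).val = 0 := by simp
  have h3 : (x + 1 + 1 - x).val = 0 := by rw [← h]; exact h0
  omega

/-- The subgraph of the cycle graph formed by the arc of `m` consecutive edges starting at `s`. -/
def arc (s : Fin (k + 3)) (m : ℕ) : (SimpleGraph.cycleGraph (k + 3)).Subgraph where
  verts := {x | (x - s).val ≤ m}
  Adj u v := (v = u + 1 ∧ (u - s).val < m) ∨ (u = v + 1 ∧ (v - s).val < m)
  adj_sub := by
    rintro u v (⟨rfl, -⟩ | ⟨rfl, -⟩)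
    · exact cycleGraph_adj_add_one _
    · exact (cycleGraph_adj_add_one _).symm
  edge_vert := by
    rintro u v (⟨rfl, h⟩ | ⟨rfl, h⟩)
    · exact h.le
    · have := val_add_one_sub v s
      simp only [Set.mem_ofPred_eq]
      omega
  symm := ⟨fun _ _ h => h.symm⟩

theorem mem_verts_arc {s x : Fin (k + 3)} {m : ℕ} : x ∈ (arc s m).verts ↔ (x - s).val ≤ m :=
  Iff.rfl

theorem arc_adj {s u v : Fin (k + 3)} {m : ℕ} :
    (arc s m).Adj u v ↔ (v = u + 1 ∧ (u - s).val < m) ∨ (u = v + 1 ∧ (v - s).val < m) :=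
  Iff.rfl

theorem arc_adj_add_one {s x : Fin (k + 3)} {m : ℕ} :
    (arc s m).Adj x (x + 1) ↔ (x - s).val < m := by
  simp [arc_adj, ne_add_one_add_one]

theorem ncard_verts_arc (s : Fin (k + 3)) {m : ℕ} (hm : m < k + 3) :
    (arc s m).verts.ncard = m + 1 := by
  have h : (arc s m).verts = (fun d => d + s) '' {d : Fin (k + 3) | d.val ≤ m} := by
    ext x
    simp only [mem_verts_arc, Set.mem_image, Set.mem_ofPred_eq]
    constructor
    · exact fun h => ⟨x - s, h, by simp⟩
    · rintro ⟨d, hd, rfl⟩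
      simpa using hd
  have h' : {d : Fin (k + 3) | d.val ≤ m} = (Finset.Iic (⟨m, hm⟩ : Fin (k + 3)) : Set _) := by
    ext d
    simp [Fin.le_def]
  rw [h, Set.ncard_image_of_injective _ (add_left_injective s), h', Set.ncard_coe_finset,
    Fin.card_Iic]

theorem arc_isTree (s : Fin (k + 3)) {m : ℕ} (hm : m < k + 3) : (arc s m).coe.IsTree := by
  have hs : s ∈ (arc s m).verts := by simp [mem_verts_arc]
  refine ⟨?_, ?_⟩
  · have key : ∀ t : ℕ, ∀ x (hx : x ∈ (arc s m).verts), (x - s).val = t →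
        (arc s m).coe.Reachable ⟨s, hs⟩ ⟨x, hx⟩ := by
      intro t
      induction t with
      | zero =>
        intro x hx hxt
        have : x = s := eq_of_val_sub_eq (s := s) (by simpa using hxt)
        subst this
        rfl
      | succ t ih =>
        intro x hx hxt
        obtain ⟨y, rfl⟩ : ∃ y, x = y + 1 := ⟨x - 1, by simp⟩
        have h1 := val_add_one_sub y s
        have hx' := mem_verts_arc.1 hx
        have hy : y ∈ (arc s m).verts := mem_verts_arc.2 (by omega)
        refine (ih y hy (by omega)).trans (SimpleGraph.Adj.reachable ?_)
        exact arc_adj_add_one.2 (by omega)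
    have : Nonempty (arc s m).verts := ⟨⟨s, hs⟩⟩
    exact ⟨fun x y => (key _ x.1 x.2 rfl).symm.trans (key _ y.1 y.2 rfl)⟩
  · refine isAcyclic_of_injective_consecutive (fun x => (x.1 - s).val)
      (fun x y h => Subtype.ext (eq_of_val_sub_eq h)) ?_
    rintro ⟨u, hu⟩ ⟨v, hv⟩ (⟨h, h1⟩ | ⟨h, h1⟩) <;> simp only at h h1 ⊢ <;> subst h
    · have := val_add_one_sub u s
      omega
    · have := val_add_one_sub v s
      omega

theorem arc_injective {s s' : Fin (k + 3)} {m m' : ℕ} (hm : m < k + 3) (hm' : m' < k + 3)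
    (h : arc s m = arc s' m') : s = s' ∧ m = m' := by
  have hmm : m = m' := by
    have := ncard_verts_arc s hm
    rw [h, ncard_verts_arc s' hm'] at this
    omega
  subst hmm
  refine ⟨?_, rfl⟩
  by_contra hne
  obtain ⟨y, rfl⟩ : ∃ y, s = y + 1 := ⟨s - 1, by simp⟩
  have h1 := val_add_one_sub y (y + 1)
  have h2 := val_add_one_sub y s'
  have h3 : y + 1 ∈ (arc s' m).verts := h ▸ mem_verts_arc.2 (by simp)
  rw [mem_verts_arc] at h3
  have h4 : (arc s' m).Adj y (y + 1) := arc_adj_add_one.2 (by omega)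
  rw [← h, arc_adj_add_one] at h4
  omega

theorem exists_not_adj_add_one_of_isAcyclic {H : (SimpleGraph.cycleGraph (k + 3)).Subgraph}
    (hH : H.coe.IsAcyclic) : ∃ b, ¬ H.Adj b (b + 1) := by
  by_contra! hall
  let f : SimpleGraph.cycleGraph (k + 3) →g H.coe :=
    { toFun := fun x => ⟨x, (hall x).fst_mem⟩
      map_rel' := by
        intro x y hxy
        rcases cycleGraph_adj_iff_add_one.1 hxy with rfl | rfl
        · exact hall _
        · exact (hall _).symm }
  have hinj : Function.Injective f := fun x y h => congrArg Subtype.val h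
  exact (hH.comap f hinj) _ SimpleGraph.cycleGraph.isCycle_cycle

/-- A subtree of the cycle graph with at least one edge is an arc. -/
theorem exists_eq_arc {H : (SimpleGraph.cycleGraph (k + 3)).Subgraph} (hH : H.coe.IsTree)
    {a : Fin (k + 3)} (ha : H.Adj a (a + 1)) : ∃ s m, m < k + 3 ∧ H = arc s m := by
  classical
  obtain ⟨b₀, hb₀⟩ := exists_not_adj_add_one_of_isAcyclic hH.isAcyclic
  let B : Finset (Fin (k + 3)) := Finset.univ.filter fun b => ¬ H.Adj b (b + 1)
  have hB : ∀ b, b ∈ B ↔ ¬ H.Adj b (b + 1) := fun b => by simp [B]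
  have hBne : B.Nonempty := ⟨b₀, (hB _).2 hb₀⟩
  -- The last missing edge before `a` determines the start of the arc.
  obtain ⟨b, hbB, hbmin⟩ := B.exists_min_image (fun b => (a - b).val) hBne
  have hb := (hB b).1 hbB
  have hs : H.Adj (b + 1) (b + 1 + 1) := by
    by_contra hcon
    have h1 := hbmin _ ((hB _).2 hcon)
    have h2 : (a - b) = (a - (b + 1)) + 1 := by abel
    have h3 := Fin.val_add_one (a - (b + 1))
    rw [← h2] at h3
    split_ifs at h3 with hl
    · have : a = b := eq_of_val_sub_eq (s := b) (by simpa using h3)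
      exact hb (this ▸ ha)
    · omega
  -- The first missing edge from there on determines its length.
  obtain ⟨c, hcB, hcmin⟩ := B.exists_min_image (fun x => (x - (b + 1)).val) hBne
  have hc := (hB c).1 hcB
  generalize hsdef : b + 1 = s at *
  have hlt : ∀ x, (x - s).val < (c - s).val → H.Adj x (x + 1) := by
    intro x hx
    by_contra hcon
    exact absurd (hcmin x ((hB _).2 hcon)) (not_le.2 hx)
  have hpos : 0 < (c - s).val := by
    rcases Nat.eq_zero_or_pos (c - s).val with h | h
    · have : c = s := eq_of_val_sub_eq (s := s) (by simpa using h)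
      exact absurd (this ▸ hs) hc
    · exact h
  refine ⟨s, (c - s).val, (c - s).isLt, ?_⟩
  have hle : ∀ u v, (arc s (c - s).val).Adj u v → H.Adj u v := by
    rintro u v (⟨rfl, h⟩ | ⟨rfl, h⟩)
    · exact hlt _ h
    · exact (hlt _ h).symm
  have hclosed : ∀ u v, H.Adj u v → u ∈ (arc s (c - s).val).verts →
      (arc s (c - s).val).Adj u v := by
    intro u v huv hu
    rw [mem_verts_arc] at hu
    rcases cycleGraph_adj_iff_add_one.1 huv.adj_sub with rfl | rfl
    · rw [arc_adj_add_one]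
      refine lt_of_le_of_ne hu fun h => hc ?_
      rwa [← eq_of_val_sub_eq h]
    · refine ((arc_adj_add_one).2 ?_).symm
      have h1 := val_add_one_sub v s
      by_cases hv : v + 1 = s
      · have : v = b := add_left_injective 1 (hv.trans hsdef.symm)
        subst this
        exact absurd (hsdef ▸ huv.symm) hb
      · omega
  have hsH : s ∈ H.verts := hs.fst_mem
  have hreach : ∀ x y : H.verts, H.coe.Walk x y → x.1 ∈ (arc s (c - s).val).verts →
      y.1 ∈ (arc s (c - s).val).verts := by
    intro x y w
    induction w with
    | nil => exact id
    | cons hxy _ ih => exact fun hx => ih (hclosed _ _ hxy hx).snd_mem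
  refine SimpleGraph.Subgraph.ext ?_ ?_
  · ext x
    constructor
    · intro hx
      obtain ⟨w⟩ := hH.connected.preconnected ⟨s, hsH⟩ ⟨x, hx⟩
      exact hreach _ _ w (by simp [mem_verts_arc])
    · intro hx
      rw [mem_verts_arc] at hx
      rcases hx.lt_or_eq with h | h
      · exact (hlt x h).fst_mem
      · obtain ⟨y, rfl⟩ : ∃ y, x = y + 1 := ⟨x - 1, by simp⟩
        have h1 := val_add_one_sub y s
        exact (hlt y (by omega)).snd_mem
  · ext u v
    refine ⟨fun huv => hclosed u v huv ?_, hle u v⟩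
    obtain ⟨w⟩ := hH.connected.preconnected ⟨s, hsH⟩ ⟨u, huv.fst_mem⟩
    exact hreach _ _ w (by simp [mem_verts_arc])

/-- Pairs `(m, d)` indexing the arcs with `m` edges whose `d`-th edge is a given one. -/
def arcIndex (k : ℕ) : Finset (ℕ × Fin (k + 3)) :=
  (Finset.range (k + 3) ×ˢ Finset.univ).filter fun p => p.2.val < p.1

theorem mem_arcIndex {p : ℕ × Fin (k + 3)} : p ∈ arcIndex k ↔ p.1 < k + 3 ∧ p.2.val < p.1 := by
  simp [arcIndex]

theorem sum_arcIndex (f : ℕ → ℝ) :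
    ∑ p ∈ arcIndex k, f p.1 = ∑ m ∈ Finset.range (k + 3), m * f m := by
  rw [arcIndex, Finset.sum_filter, Finset.sum_product]
  refine Finset.sum_congr rfl fun m hm => ?_
  have hm' : m < k + 3 := Finset.mem_range.1 hm
  have : (Finset.univ.filter fun d : Fin (k + 3) => d.val < m) = Finset.Iio ⟨m, hm'⟩ := by
    ext d
    simp [Fin.lt_def]
  rw [← Finset.sum_filter, this]
  simp

theorem injOn_arc_sub (a : Fin (k + 3)) :
    Set.InjOn (fun p : ℕ × Fin (k + 3) => arc (a - p.2) p.1) (arcIndex k) := by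
  rintro ⟨m, d⟩ hp ⟨m', d'⟩ hp' h
  obtain ⟨h1, h2⟩ := arc_injective (mem_arcIndex.1 hp).1 (mem_arcIndex.1 hp').1 h
  exact Prod.ext h2 (sub_right_injective h1)

theorem subtrees_cycleGraph_mem_edge (a : Fin (k + 3)) :
    {H ∈ subtrees (SimpleGraph.cycleGraph (k + 3)) | s(a, a + 1) ∈ H.edgeSet} =
      (fun p : ℕ × Fin (k + 3) => arc (a - p.2) p.1) '' (arcIndex k) := by
  ext H
  simp only [Set.mem_ofPred_eq, SimpleGraph.Subgraph.mem_edgeSet, Set.mem_image, Finset.mem_coe,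
    mem_arcIndex, subtrees]
  constructor
  · rintro ⟨hH, ha⟩
    obtain ⟨s, m, hm, rfl⟩ := exists_eq_arc hH ha
    exact ⟨(m, a - s), ⟨hm, arc_adj_add_one.1 ha⟩, by simp⟩
  · rintro ⟨⟨m, d⟩, ⟨hm, hd⟩, rfl⟩
    exact ⟨arc_isTree _ hm, arc_adj_add_one.2 (by simpa using hd)⟩

end Arc

theorem sum_range_natCast_mul_one (n : ℕ) :
    ∑ m ∈ Finset.range n, (m : ℝ) * 1 = n * (n - 1) / 2 := by
  induction n with
  | zero => simp
  | succ n ih => rw [Finset.sum_range_succ, ih]; push_cast; ring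

theorem sum_range_natCast_mul_succ (n : ℕ) :
    ∑ m ∈ Finset.range n, (m : ℝ) * (m + 1) = (n - 1) * n * (n + 1) / 3 := by
  induction n with
  | zero => simp
  | succ n ih => rw [Finset.sum_range_succ, ih]; push_cast; ring

/-- For `n ≥ 3` and an edge `e` of the cycle `C_n`, `μ(C_n, e) = (2n+2)/3`. -/
theorem cycleGraph_muEdge (n : ℕ) (hn : 3 ≤ n)
    (e : Sym2 (Fin n)) (he : e ∈ (SimpleGraph.cycleGraph n).edgeSet) :
    muEdge (SimpleGraph.cycleGraph n) e = (2 * (n : ℝ) + 2) / 3 := by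
  obtain ⟨k, rfl⟩ : ∃ k, n = k + 3 := ⟨n - 3, by omega⟩
  obtain ⟨a, rfl⟩ : ∃ a, e = s(a, a + 1) := by
    induction e using Sym2.ind with
    | _ u v =>
      rw [SimpleGraph.mem_edgeSet] at he
      rcases cycleGraph_adj_iff_add_one.1 he with rfl | rfl
      · exact ⟨u, rfl⟩
      · exact ⟨v, Sym2.eq_swap⟩
  have hcard : ((arcIndex k).card : ℝ) = ((k + 3 : ℕ) : ℝ) * ((k + 3 : ℕ) - 1) / 2 := by
    rw [← sum_range_natCast_mul_one, ← sum_arcIndex fun _ => 1]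
    simp
  have hsum : ∑ p ∈ arcIndex k, ((arc (a - p.2) p.1).verts.ncard : ℝ) =
      (((k + 3 : ℕ) : ℝ) - 1) * (k + 3 : ℕ) * ((k + 3 : ℕ) + 1) / 3 := by
    rw [← sum_range_natCast_mul_succ, ← sum_arcIndex fun m => (m : ℝ) + 1]
    refine Finset.sum_congr rfl fun p hp => ?_
    rw [ncard_verts_arc _ (mem_arcIndex.1 hp).1]
    push_cast
    rfl
  rw [muEdge, subtrees_cycleGraph_mem_edge, finsum_mem_image (injOn_arc_sub a),
    finsum_mem_coe_finset, (injOn_arc_sub a).ncard_image, Set.ncard_coe_finset,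
    hcard, hsum]
  have h1 : ((k + 3 : ℕ) : ℝ) - 1 ≠ 0 := by
    apply ne_of_gt
    push_cast
    have : (0 : ℝ) ≤ k := k.cast_nonneg
    linarith
  have h2 : ((k + 3 : ℕ) : ℝ) ≠ 0 := by positivity
  field_simp

end SubtreePaper
end
end

section
/- Let G be the simple graph on the 7 vertices a, b, c, d, e, f, g with edge set {ac, bc, ad, ae, af, ag, bd, be, bf, bg, de, fg}, and let H be obtained from G by adding the edge ab. Then G is connected, a and b are nonadjacent in G, and μ(H) < μ(G). -/
open Filter Topology

noncomputable section

namespace SubtreePaper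

/-- The smallest counterexample: the graph on vertices `a = 0, b = 1, c = 2, d = 3,
e = 4, f = 5, g = 6` with edges `ac, bc, ad, ae, af, ag, bd, be, bf, bg, de, fg`. -/
def counterexampleGraph : SimpleGraph (Fin 7) :=
  SimpleGraph.fromEdgeSet
    {s(0, 2), s(1, 2), s(0, 3), s(0, 4), s(0, 5), s(0, 6),
     s(1, 3), s(1, 4), s(1, 5), s(1, 6), s(3, 4), s(5, 6)}

/-- Start from the vertex labelling `f` and, for each edge of the list in turn, identify the
labels of its two ends. -/
def mergeLabels {V : Type*} [DecidableEq V] : List (V × V) → (V → V) → V → V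
  | [], f => f
  | e :: E, f => mergeLabels E (fun x => if f x = f e.1 then f e.2 else f x)

/-- The pairs of a vertex list and an edge list, taken as sublists of `vs` and `l`, which
describe the trees with edges in `l`. -/
def treeList {V : Type*} [DecidableEq V] (vs : List V) (l : List (V × V)) :
    List (List V × List (V × V)) :=
  vs.sublists.flatMap fun s =>
    (((l.filter fun e => e.1 ∈ s ∧ e.2 ∈ s).sublistsLen (s.length - 1)).filter fun E =>
      s.length = E.length + 1 ∧
        ∀ x ∈ s, ∀ y ∈ s.head?, mergeLabels E id x = mergeLabels E id y).map (s, ·)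

section

variable {V : Type*}

lemma mergeLabels_eq_iff [DecidableEq V] (E : List (V × V)) (f : V → V) (x y : V) :
    mergeLabels E f x = mergeLabels E f y ↔
      Relation.EqvGen (fun a b => f a = f b ∨ (a, b) ∈ E) x y := by
  induction E generalizing f x y with
  | nil =>
    simp only [mergeLabels, List.not_mem_nil, or_false]
    refine ⟨fun h => .rel _ _ h, fun h => ?_⟩
    induction h with
    | rel _ _ h => exact h
    | refl => rfl
    | symm _ _ _ ih => exact ih.symm
    | trans _ _ _ _ _ ih₁ ih₂ => exact ih₁.trans ih₂
  | cons e E ih =>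
    obtain ⟨u, v⟩ := e
    rw [mergeLabels, ih]
    constructor
    · intro h
      induction h with
      | refl => exact .refl _
      | symm _ _ _ ih => exact ih.symm
      | trans _ _ _ _ _ ih₁ ih₂ => exact ih₁.trans _ _ _ ih₂
      | rel a b h =>
        have huv : Relation.EqvGen (fun a b => f a = f b ∨ (a, b) ∈ (u, v) :: E) u v :=
          .rel _ _ (by simp)
        have hf : ∀ {a b}, f a = f b →
            Relation.EqvGen (fun a b => f a = f b ∨ (a, b) ∈ (u, v) :: E) a b :=
          fun h => .rel _ _ (.inl h)
        rcases h with h | h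
        · dsimp only at h
          split_ifs at h with h₁ h₂ h₂
          · exact hf (h₁.trans h₂.symm)
          · exact (hf h₁).trans _ _ _ (huv.trans _ _ _ (hf h))
          · exact (hf h).trans _ _ _ (huv.symm.trans _ _ _ (hf h₂.symm))
          · exact hf h
        · exact .rel _ _ (.inr (List.mem_cons_of_mem _ h))
    · intro h
      induction h with
      | refl => exact .refl _
      | symm _ _ _ ih => exact ih.symm
      | trans _ _ _ _ _ ih₁ ih₂ => exact ih₁.trans _ _ _ ih₂
      | rel a b h =>
        rcases h with h | h
        · exact .rel _ _ (.inl (by simp [h]))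
        · rcases List.mem_cons.1 h with h | h
          · obtain ⟨rfl, rfl⟩ := Prod.mk.inj h
            exact .rel _ _ (.inl (by simp))
          · exact .rel _ _ (.inr h)

lemma mem_treeList [DecidableEq V] {vs : List V} {l : List (V × V)} {p : List V × List (V × V)} :
    p ∈ treeList vs l ↔
      p.1.Sublist vs ∧ p.2.Sublist (l.filter fun e => e.1 ∈ p.1 ∧ e.2 ∈ p.1) ∧
        p.1.length = p.2.length + 1 ∧
          ∀ x ∈ p.1, ∀ y ∈ p.1, mergeLabels p.2 id x = mergeLabels p.2 id y := by
  obtain ⟨s, E⟩ := p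
  simp only [treeList, List.mem_flatMap, List.mem_map, List.mem_filter, List.mem_sublists,
    List.mem_sublistsLen, decide_eq_true_eq, Prod.mk.injEq]
  constructor
  · rintro ⟨s, hs, E, ⟨⟨hE, -⟩, hlen, h⟩, rfl, rfl⟩
    refine ⟨hs, hE, hlen, ?_⟩
    cases s with
    | nil => simp
    | cons z s =>
      intro x hx y hy
      exact (h x hx z rfl).trans (h y hy z rfl).symm
  · rintro ⟨hs, hE, hlen, h⟩
    exact ⟨s, hs, E, ⟨⟨hE, by omega⟩, hlen,
      fun x hx y hy => h x hx y (List.mem_of_mem_head? hy)⟩, rfl, rfl⟩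

lemma nodup_treeList [DecidableEq V] {vs : List V} {l : List (V × V)} (hvs : vs.Nodup) (hl : l.Nodup) :
    (treeList vs l).Nodup := by
  rw [treeList, List.nodup_flatMap]
  refine ⟨fun s _ => ((List.nodup_sublistsLen _ (hl.filter _)).filter _).map
    (Prod.mk_right_injective s), (List.nodup_sublists.2 hvs).imp fun {s t} hst => ?_⟩
  rintro ⟨a, b⟩ ha hb
  simp only [List.mem_map, Prod.mk.injEq] at ha hb
  obtain ⟨_, _, rfl, _⟩ := ha
  obtain ⟨_, _, rfl, _⟩ := hb
  exact hst rfl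

lemma connected_coe_iff {G : SimpleGraph V} (H : G.Subgraph) :
    H.coe.Connected ↔
      H.verts.Nonempty ∧ ∀ x ∈ H.verts, ∀ y ∈ H.verts, Relation.EqvGen H.Adj x y := by
  rw [SimpleGraph.connected_iff, and_comm, Set.nonempty_coe_sort]
  refine and_congr_right fun _ => ⟨fun h x hx y hy => ?_, fun h => ?_⟩
  · have := (SimpleGraph.reachable_iff_reflTransGen _ _).1 (h ⟨x, hx⟩ ⟨y, hy⟩)
    generalize hb : (⟨y, hy⟩ : H.verts) = b at this
    rw [show y = b by rw [← hb]]
    clear hb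
    induction this with
    | refl => exact .refl _
    | tail _ hab ih => exact ih.trans _ _ _ (.rel _ _ hab)
  · have key : ∀ x y, Relation.EqvGen H.Adj x y →
        x = y ∨ ∃ (hx : x ∈ H.verts) (hy : y ∈ H.verts), H.coe.Reachable ⟨x, hx⟩ ⟨y, hy⟩ := by
      intro x y h
      induction h with
      | rel a b h =>
        exact .inr ⟨h.fst_mem, h.snd_mem, SimpleGraph.Adj.reachable (by simpa using h)⟩
      | refl => exact .inl rfl
      | symm _ _ _ ih =>
        rcases ih with rfl | ⟨hx, hy, h⟩
        · exact .inl rfl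
        · exact .inr ⟨hy, hx, h.symm⟩
      | trans _ _ _ _ _ ih₁ ih₂ =>
        rcases ih₁ with rfl | ⟨hx, hy, h⟩
        · exact ih₂
        · rcases ih₂ with rfl | ⟨hy', hz, h'⟩
          · exact .inr ⟨hx, hy, h⟩
          · exact .inr ⟨hx, hz, h.trans h'⟩
    rintro ⟨x, hx⟩ ⟨y, hy⟩
    rcases key x y (h x hx y hy) with rfl | ⟨_, _, h⟩
    · exact .refl _
    · exact h

lemma ncard_setOf_mem {α : Type*} {s : List α} (hs : s.Nodup) : {x | x ∈ s}.ncard = s.length := by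
  classical
  rw [← List.toFinset_card_of_nodup hs, ← Set.ncard_coe_finset, List.coe_toFinset]

lemma isTree_coe_iff [DecidableEq V] [Finite V] {G : SimpleGraph V} (H : G.Subgraph) {s : List V}
    {E : List (V × V)} (hs : s.Nodup) (hsH : ∀ x, x ∈ s ↔ x ∈ H.verts) (hE : E.Nodup)
    (hswap : ∀ e ∈ E, e.swap ∉ E) (hEH : ∀ u v, H.Adj u v ↔ (u, v) ∈ E ∨ (v, u) ∈ E) :
    H.coe.IsTree ↔ s.length = E.length + 1 ∧
      ∀ x ∈ s, ∀ y ∈ s, mergeLabels E id x = mergeLabels E id y := by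
  have hverts : Nat.card H.verts = s.length := by
    rw [Nat.card_coe_set_eq, ← ncard_setOf_mem hs]
    congr 1
    ext x
    exact (hsH x).symm
  have hedges : Nat.card H.coe.edgeSet = E.length := by
    have hinj : Set.InjOn (fun e : V × V => s(e.1, e.2)) {e | e ∈ E} := by
      rintro ⟨a, b⟩ ha ⟨c, d⟩ hc h
      rcases Sym2.eq_iff.1 h with ⟨rfl, rfl⟩ | ⟨rfl, rfl⟩
      · rfl
      · exact absurd ha (hswap _ hc)
    have himage : H.edgeSet = (fun e : V × V => s(e.1, e.2)) '' {e | e ∈ E} := by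
      ext e
      induction e with
      | _ u v =>
        simp only [SimpleGraph.Subgraph.mem_edgeSet, hEH, Set.mem_image, Set.mem_ofPred_eq,
          Prod.exists, Sym2.eq_iff]
        constructor
        · rintro (h | h)
          · exact ⟨u, v, h, .inl ⟨rfl, rfl⟩⟩
          · exact ⟨v, u, h, .inr ⟨rfl, rfl⟩⟩
        · rintro ⟨a, b, h, ⟨rfl, rfl⟩ | ⟨rfl, rfl⟩⟩
          · exact .inl h
          · exact .inr h
    rw [Nat.card_coe_set_eq, ← Set.InjOn.ncard_image
      (Sym2.map.injective Subtype.val_injective).injOn, H.image_coe_edgeSet_coe, himage,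
      hinj.ncard_image, ncard_setOf_mem hE]
  have hgen : ∀ x y, Relation.EqvGen H.Adj x y ↔ mergeLabels E id x = mergeLabels E id y := by
    intro x y
    rw [mergeLabels_eq_iff]
    constructor <;> intro h <;> induction h with
      | refl => exact .refl _
      | symm _ _ _ ih => exact ih.symm
      | trans _ _ _ _ _ ih₁ ih₂ => exact ih₁.trans _ _ _ ih₂
      | rel a b h => ?_
    · rcases (hEH a b).1 h with h | h
      · exact .rel _ _ (.inr h)
      · exact .symm _ _ (.rel _ _ (.inr h))
    · rcases h with rfl | h
      · exact .refl _
      · exact .rel _ _ ((hEH a b).2 (.inl h))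
  rw [SimpleGraph.isTree_iff_connected_and_card, connected_coe_iff, hverts, hedges]
  simp only [hgen, ← hsH]
  constructor
  · rintro ⟨⟨-, h⟩, hlen⟩
    exact ⟨hlen.symm, h⟩
  · rintro ⟨hlen, h⟩
    refine ⟨⟨?_, h⟩, hlen.symm⟩
    obtain ⟨x, hx⟩ := List.exists_mem_of_length_pos (l := s) (by omega)
    exact ⟨x, (hsH x).1 hx⟩

lemma filter_eq_of_sublist {α : Type*} {l m : List α} {p : α → Bool} (hl : l.Nodup)
    (hm : m.Sublist l) (hp : ∀ x ∈ l, p x = true ↔ x ∈ m) : l.filter p = m := by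
  refine (hl.perm_iff_eq_of_sublist List.filter_sublist hm).1 ?_
  rw [List.perm_ext_iff_of_nodup (hl.filter _) (hl.sublist hm)]
  intro x
  rw [List.mem_filter]
  exact ⟨fun h => (hp x h.1).1 h.2, fun h => ⟨hm.subset h, (hp x (hm.subset h)).2 h⟩⟩

open Classical in
/-- The lists of vertices and edges of a subgraph, as sublists of `vs` and `l`. -/
def subgraphLists {G : SimpleGraph V} (vs : List V) (l : List (V × V)) (H : G.Subgraph) :
    List V × List (V × V) :=
  (vs.filter (· ∈ H.verts), l.filter fun e => H.Adj e.1 e.2)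

section

variable {G : SimpleGraph V} {vs : List V} {l : List (V × V)}

lemma mem_subgraphLists_fst (hvs : ∀ x, x ∈ vs) (H : G.Subgraph) (x : V) :
    x ∈ (subgraphLists vs l H).1 ↔ x ∈ H.verts := by
  simp [subgraphLists, hvs]

lemma adj_iff_mem_subgraphLists_snd (hG : ∀ u v, G.Adj u v ↔ (u, v) ∈ l ∨ (v, u) ∈ l)
    (H : G.Subgraph) (u v : V) :
    H.Adj u v ↔ (u, v) ∈ (subgraphLists vs l H).2 ∨ (v, u) ∈ (subgraphLists vs l H).2 := by
  simp only [subgraphLists, List.mem_filter, decide_eq_true_eq, H.adj_comm v u, ← or_and_right,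
    ← hG]
  exact ⟨fun h => ⟨h.adj_sub, h⟩, fun h => h.2⟩

lemma subgraphLists_injective (hvs : ∀ x, x ∈ vs)
    (hG : ∀ u v, G.Adj u v ↔ (u, v) ∈ l ∨ (v, u) ∈ l) :
    Function.Injective (subgraphLists (G := G) vs l) := by
  intro H K h
  apply SimpleGraph.Subgraph.ext
  · ext x
    rw [← mem_subgraphLists_fst (l := l) hvs, h, mem_subgraphLists_fst hvs]
  · ext u v
    rw [adj_iff_mem_subgraphLists_snd (vs := vs) hG, h, ← adj_iff_mem_subgraphLists_snd hG]

lemma image_subgraphLists_subtrees [DecidableEq V] [Finite V] (hvs : ∀ x, x ∈ vs) (hvs' : vs.Nodup)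
    (hl : l.Nodup) (hswap : ∀ e ∈ l, e.swap ∉ l)
    (hG : ∀ u v, G.Adj u v ↔ (u, v) ∈ l ∨ (v, u) ∈ l) :
    subgraphLists vs l '' subtrees G = ((treeList vs l).toFinset : Set _) := by
  have htree : ∀ H : G.Subgraph, H ∈ subtrees G ↔ _ := fun H =>
    isTree_coe_iff H (s := (subgraphLists vs l H).1) (E := (subgraphLists vs l H).2)
      (hvs'.filter _) (mem_subgraphLists_fst hvs H) (hl.filter _)
      (fun e he he' => hswap e (List.mem_of_mem_filter he) (List.mem_of_mem_filter he'))
      (adj_iff_mem_subgraphLists_snd hG H)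
  ext p
  rw [List.coe_toFinset, Set.mem_ofPred_eq, mem_treeList, Set.mem_image]
  constructor
  · rintro ⟨H, hH, rfl⟩
    refine ⟨List.filter_sublist, ?_, (htree H).1 hH⟩
    refine List.monotone_filter_right _ fun e he => decide_eq_true ?_
    have he : H.Adj e.1 e.2 := by simpa using he
    exact ⟨(mem_subgraphLists_fst hvs H _).2 he.fst_mem,
      (mem_subgraphLists_fst hvs H _).2 he.snd_mem⟩
  · rintro ⟨hs, hE, h⟩
    obtain ⟨s, E⟩ := p
    dsimp only at hs hE h
    have hE' : E.Sublist l := hE.trans List.filter_sublist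
    have hmem : ∀ {u v}, (u, v) ∈ E → u ∈ s ∧ v ∈ s := fun h => by
      simpa using List.of_mem_filter (hE.subset h)
    let H : G.Subgraph :=
      { verts := {x | x ∈ s}
        Adj := fun u v => (u, v) ∈ E ∨ (v, u) ∈ E
        adj_sub := fun h => (hG _ _).2 (h.imp (hE'.subset ·) (hE'.subset ·))
        edge_vert := fun h => h.elim (fun h => (hmem h).1) (fun h => (hmem h).2)
        symm := ⟨fun _ _ h => h.symm⟩ }
    have hH : subgraphLists vs l H = (s, E) := by
      refine Prod.ext ?_ ?_
      · exact filter_eq_of_sublist hvs' hs (by simp [H])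
      · refine filter_eq_of_sublist hl hE' fun e he => ?_
        simp only [H, decide_eq_true_eq, or_iff_left_iff_imp]
        exact fun h => absurd (hE'.subset h) (hswap e he)
    refine ⟨H, (htree H).2 ?_, hH⟩
    rw [hH]
    exact h

lemma mu_eq_of_treeList [DecidableEq V] [Finite V] (hvs : ∀ x, x ∈ vs) (hvs' : vs.Nodup)
    (hl : l.Nodup) (hswap : ∀ e ∈ l, e.swap ∉ l)
    (hG : ∀ u v, G.Adj u v ↔ (u, v) ∈ l ∨ (v, u) ∈ l) :
    mu G = (((treeList vs l).map (·.1.length)).sum : ℕ) / ((treeList vs l).length : ℝ) := by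
  have hinj := (subgraphLists_injective hvs hG).injOn (s := subtrees G)
  have himage := image_subgraphLists_subtrees hvs hvs' hl hswap hG
  have hnodup := nodup_treeList hvs' hl
  rw [mu, numSubtrees, ← hinj.ncard_image, himage, Set.ncard_coe_finset,
    List.toFinset_card_of_nodup hnodup]
  congr 1
  have hverts : ∀ H : G.Subgraph, (H.verts.ncard : ℝ) = (subgraphLists vs l H).1.length := by
    intro H
    rw [← ncard_setOf_mem (s := (subgraphLists vs l H).1) (hvs'.filter _)]
    simp [mem_subgraphLists_fst hvs]
  simp only [hverts]
  rw [← finsum_mem_image (f := fun p : List V × List (V × V) => (p.1.length : ℝ)) hinj, himage,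
    finsum_mem_coe_finset, ← List.sum_toFinset _ hnodup, Nat.cast_sum]

end

end

/-- The edges of `counterexampleGraph`. -/
def counterexampleEdges : List (Fin 7 × Fin 7) :=
  [(0, 2), (1, 2), (0, 3), (0, 4), (0, 5), (0, 6), (1, 3), (1, 4), (1, 5), (1, 6), (3, 4), (5, 6)]

lemma counterexampleGraph_adj (u v : Fin 7) :
    counterexampleGraph.Adj u v ↔
      (u, v) ∈ counterexampleEdges ∨ (v, u) ∈ counterexampleEdges := by
  simp only [counterexampleGraph, SimpleGraph.fromEdgeSet_adj, Set.mem_insert_iff,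
    Set.mem_singleton_iff]
  revert u v
  decide

lemma addEdge_counterexampleGraph_adj (u v : Fin 7) :
    (addEdge counterexampleGraph 0 1).Adj u v ↔
      (u, v) ∈ (0, 1) :: counterexampleEdges ∨ (v, u) ∈ (0, 1) :: counterexampleEdges := by
  simp only [addEdge, SimpleGraph.sup_adj, counterexampleGraph_adj, SimpleGraph.fromEdgeSet_adj,
    Set.mem_singleton_iff]
  revert u v
  decide

lemma mu_counterexampleGraph : mu counterexampleGraph = 6320 / 1100 := by
  have h : ((treeList (List.finRange 7) counterexampleEdges).map (·.1.length)).sum = 6320 ∧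
      (treeList (List.finRange 7) counterexampleEdges).length = 1100 := by decide +kernel
  rw [mu_eq_of_treeList List.mem_finRange (List.nodup_finRange 7) (by decide) (by decide)
    counterexampleGraph_adj, h.1, h.2]
  norm_num

lemma mu_addEdge_counterexampleGraph : mu (addEdge counterexampleGraph 0 1) = 9232 / 1607 := by
  have h :
      ((treeList (List.finRange 7) ((0, 1) :: counterexampleEdges)).map (·.1.length)).sum = 9232 ∧
        (treeList (List.finRange 7) ((0, 1) :: counterexampleEdges)).length = 1607 := by
    decide +kernel
  rw [mu_eq_of_treeList List.mem_finRange (List.nodup_finRange 7) (by decide) (by decide)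
    addEdge_counterexampleGraph_adj, h.1, h.2]
  norm_num

lemma counterexampleGraph_connected : counterexampleGraph.Connected := by
  have h₀ : counterexampleGraph.Adj 2 0 := by
    rw [counterexampleGraph_adj]
    decide
  have h : ∀ v, v = 0 ∨ v = 1 ∨ counterexampleGraph.Adj 0 v := by
    simp only [counterexampleGraph_adj]
    decide
  have h₁ : counterexampleGraph.Adj 2 1 := by
    rw [counterexampleGraph_adj]
    decide
  refine (SimpleGraph.connected_iff_exists_forall_reachable _).2 ⟨2, fun v => ?_⟩
  rcases h v with rfl | rfl | h
  · exact h₀.reachable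
  · exact h₁.reachable
  · exact h₀.reachable.trans h.reachable

/-- The graph above is connected, `a` and `b` are nonadjacent, and adding the edge `ab`
decreases the mean subtree order. -/
theorem counterexample_of_order_seven :
    counterexampleGraph.Connected ∧ ¬ counterexampleGraph.Adj 0 1 ∧
      mu (addEdge counterexampleGraph 0 1) < mu counterexampleGraph := by
  refine ⟨counterexampleGraph_connected, ?_, ?_⟩
  · rw [counterexampleGraph_adj]
    decide
  · rw [mu_counterexampleGraph, mu_addEdge_counterexampleGraph]
    norm_num

end SubtreePaper
end
end
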